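/- arXiv:1304.0176 — 3 statements merged into one kernel-verified Lean document; each statement's English description precedes it below -/
import Mathlib

section
/- Let X be a complex Banach space, T a bounded linear operator on X, x ∈ X, and let (f(n)) be a sequence of real numbers with the following property: there exist an integer d ≥ 0, sequences (g_l(n))_n of real numbers for 0 ≤ l ≤ d, and sequences (ε_k(n))_n of real numbers for each k ≥ 1, such that for all n, k ≥ 1, f(n+k) − f(n) = Σ_{l=0}^{d} g_l(n) k^l + ε_k(n), and for each fixed k ≥ 1, |ε_k(n)| → 0 as n → ∞. Then the following are equivalent: (i) x is hypercyclic for T; (ii) the set {e^{i f(n)} T^n x : n ≥ 1} is dense in X. -/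
open Filter Topology

section Hypercyclicity

open Polynomial Set Function

/-! ### Dense range of polynomials in the operator -/

section DenseRange

variable {X : Type*} [NormedAddCommGroup X] [NormedSpace ℂ X]

/-- Elements of the projective orbit with unimodular scalars. -/
def rotatedOrbit (T : X →L[ℂ] X) (x : X) : Set X :=
  range fun p : Circle × ℕ => (p.1 : ℂ) • (T ^ p.2) x

/-- A continuous linear map for which `T` acts by a scalar vanishes when `T` has a dense
rotated orbit. -/
theorem eq_zero_of_dense_rotatedOrbit {Q : Type*} [SeminormedAddCommGroup Q] [NormedSpace ℂ Q]
    {T : X →L[ℂ] X} {x : X} (hx : Dense (rotatedOrbit T x)) (φ : X →ₗ[ℂ] Q) (hφ : Continuous φ)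
    (μ : ℂ) (hT : ∀ y, φ (T y) = μ • φ y) (y : X) : ‖φ y‖ = 0 := by
  have hcont : Continuous fun y => ‖φ y‖ := hφ.norm
  have hpow : ∀ n : ℕ, φ ((T ^ n) x) = μ ^ n • φ x := by
    intro n
    induction n with
    | zero => simp
    | succ n ih => rw [pow_succ', mul_apply_eq_comp, hT, ih, smul_smul, pow_succ']
  have hval : ∀ p : Circle × ℕ, ‖φ ((p.1 : ℂ) • (T ^ p.2) x)‖ = ‖μ‖ ^ p.2 * ‖φ x‖ := by
    intro p
    rw [map_smul, hpow, norm_smul, norm_smul, norm_pow, Circle.norm_coe, one_mul]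
  rcases le_total ‖μ‖ 1 with hμ | hμ
  · have hbound : ∀ z, ‖φ z‖ ≤ ‖φ x‖ := by
      intro z
      refine hx.induction (P := fun z => ‖φ z‖ ≤ ‖φ x‖) ?_
        (isClosed_le hcont continuous_const) z
      rintro _ ⟨p, rfl⟩
      simp only [hval]
      exact mul_le_of_le_one_left (norm_nonneg _) (pow_le_one₀ (norm_nonneg _) hμ)
    by_contra hne
    have hpos : 0 < ‖φ y‖ := lt_of_le_of_ne (norm_nonneg _) (Ne.symm hne)
    obtain ⟨n, hn⟩ := exists_nat_gt (‖φ x‖ / ‖φ y‖)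
    have := hbound ((n : ℂ) • y)
    rw [map_smul, norm_smul, Complex.norm_natCast] at this
    rw [div_lt_iff₀ hpos] at hn
    linarith
  · have hbound : ∀ z, ‖φ x‖ ≤ ‖φ z‖ := by
      intro z
      refine hx.induction (P := fun z => ‖φ x‖ ≤ ‖φ z‖) ?_
        (isClosed_le continuous_const hcont) z
      rintro _ ⟨p, rfl⟩
      simp only [hval]
      exact le_mul_of_one_le_left (norm_nonneg _) (one_le_pow₀ hμ)
    have hx0 : ‖φ x‖ = 0 := le_antisymm (by simpa using hbound 0) (norm_nonneg _)
    refine hx.induction (P := fun z => ‖φ z‖ = 0) ?_ (isClosed_eq hcont continuous_const) y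
    rintro _ ⟨p, rfl⟩
    simp only [hval, hx0, mul_zero]

theorem denseRange_sub_smul_of_dense_rotatedOrbit {T : X →L[ℂ] X} {x : X}
    (hx : Dense (rotatedOrbit T x)) (μ : ℂ) :
    DenseRange (T - algebraMap ℂ (X →L[ℂ] X) μ) := by
  set R : X →L[ℂ] X := T - algebraMap ℂ (X →L[ℂ] X) μ with hR
  let K : Submodule ℂ X := LinearMap.range (R : X →ₗ[ℂ] X)
  intro y
  have hcont : Continuous K.mkQ := continuous_quot_mk
  have hT : ∀ y, K.mkQ (T y) = μ • K.mkQ y := by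
    intro y
    rw [← map_smul, ← sub_eq_zero, ← map_sub, Submodule.mkQ_apply, Submodule.Quotient.mk_eq_zero]
    exact ⟨y, by simp [hR, Algebra.algebraMap_eq_smul_one]⟩
  have := eq_zero_of_dense_rotatedOrbit hx K.mkQ hcont μ hT y
  exact (QuotientAddGroup.norm_mk_eq_zero_iff_mem_closure (S := K.toAddSubgroup)).1 this

theorem denseRange_aeval_of_dense_rotatedOrbit {T : X →L[ℂ] X} {x : X}
    (hx : Dense (rotatedOrbit T x)) {q : ℂ[X]} (hq : q ≠ 0) :
    DenseRange (aeval T q) := by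
  rw [(IsAlgClosed.splits q).eq_prod_roots, map_mul, aeval_C]
  have hmul : ∀ A B : X →L[ℂ] X, DenseRange A → DenseRange B → DenseRange (A * B) :=
    fun A B hA hB => hA.comp hB A.continuous
  refine hmul _ _ ?_ ?_
  · refine Surjective.denseRange fun y => ⟨q.leadingCoeff⁻¹ • y, ?_⟩
    simp [Algebra.algebraMap_eq_smul_one, smul_smul, inv_mul_cancel₀ (leadingCoeff_ne_zero.2 hq)]
  · induction q.roots using Multiset.induction_on with
    | empty => simpa using denseRange_id
    | cons a s ih =>
      rw [Multiset.map_cons, Multiset.prod_cons, map_mul]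
      refine hmul _ _ ?_ ih
      simpa using denseRange_sub_smul_of_dense_rotatedOrbit hx a

end DenseRange

/-! ### Lifting circle-valued characters -/

theorem exists_continuous_circleExp_lift {P : Type*} [TopologicalSpace P] [ContractibleSpace P]
    (h : C(P, Circle)) : ∃ ψ : C(P, ℝ), ∀ p, Circle.exp (ψ p) = h p := by
  obtain ⟨p₀, ⟨H⟩⟩ := id_nullhomotopic P
  obtain ⟨a, ha⟩ := Circle.exp_surjective (h p₀)
  let G : C(unitInterval × P, Circle) := h.comp H.symm.toContinuousMap
  have G0 : ∀ p, G (0, p) = Circle.exp (ContinuousMap.const P a p) := fun p => by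
    simp [G, ha]
  let L := Circle.isCoveringMap_exp.liftHomotopy G (ContinuousMap.const P a) G0
  refine ⟨L.comp ⟨fun p => (1, p), by fun_prop⟩, fun p => ?_⟩
  have := congr_fun (Circle.isCoveringMap_exp.liftHomotopy_lifts G (ContinuousMap.const P a) G0)
    (1, p)
  exact this.trans (by simp [G])

/-- A continuous circle-valued character of a contractible monoid lifts to a real-valued one. -/
theorem exists_continuous_additive_circleExp_lift {P : Type*} [CommMonoid P] [TopologicalSpace P]
    [ContractibleSpace P] (hmul : ∀ q : P, Continuous fun r => q * r) (h : P → Circle)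
    (hcont : Continuous h) (hh : ∀ q r, h (q * r) = h q * h r) :
    ∃ ψ : P → ℝ, Continuous ψ ∧ (∀ q r, ψ (q * r) = ψ q + ψ r) ∧
      ∀ q, Circle.exp (ψ q) = h q := by
  obtain ⟨L, hL⟩ := exists_continuous_circleExp_lift ⟨h, hcont⟩
  simp only [ContinuousMap.coe_mk] at hL
  have h1 : h 1 = 1 := by simpa using hh 1 1
  have hψ : ∀ q, Circle.exp (L q - L 1) = h q := fun q => by
    rw [Circle.exp_sub, hL, hL, h1, div_one]
  refine ⟨fun q => L q - L 1, by fun_prop, fun q r => ?_, hψ⟩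
  have hLq : Continuous fun r => L (q * r) := L.continuous.comp (hmul q)
  have key := Circle.isCoveringMap_exp.const_of_comp
    (g := fun r => (L (q * r) - L 1) - (L q - L 1) - (L r - L 1)) (by fun_prop)
    (fun a b => by simp only [Circle.exp_sub _ (L a - L 1), Circle.exp_sub _ (L b - L 1),
                    Circle.exp_sub _ (L q - L 1), hψ, hh]; simp) r 1
  simp only [mul_one] at key
  linarith

/-! ### Closed subsemigroups of the circle -/

theorem circle_closed_subsemigroup {H : Set Circle} (hne : H.Nonempty) (hcl : IsClosed H)
    (hmul : ∀ a ∈ H, ∀ b ∈ H, a * b ∈ H) :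
    H = univ ∨ ∃ k : ℕ, 1 ≤ k ∧ ∀ ζ : Circle, ζ ∈ H ↔ ζ ^ k = 1 := by
  have hpow : ∀ a ∈ H, ∀ n : ℕ, a ^ (n + 1) ∈ H := by
    intro a ha n
    induction n with
    | zero => simpa
    | succ n ih => rw [pow_succ]; exact hmul _ ih _ ha
  have hcluster : ∀ a ∈ H, ∀ b, MapClusterPt b atTop (a ^ · : ℕ → Circle) → b ∈ H := by
    intro a ha b hb
    refine hcl.mem_of_mapClusterPt hb ?_
    filter_upwards [eventually_ge_atTop 1] with n hn
    obtain ⟨m, rfl⟩ := Nat.exists_eq_add_of_le' hn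
    exact hpow a ha m
  obtain ⟨a₀, ha₀⟩ := hne
  let G : AddSubgroup ℝ :=
    { carrier := {s | Circle.exp s ∈ H}
      zero_mem' := by
        simpa using hcluster a₀ ha₀ 1 (mapClusterPt_one_atTop_pow a₀)
      add_mem' := fun {a b} ha hb => by
        simp only [mem_ofPred_eq, Circle.exp_add] at *
        exact hmul _ ha _ hb
      neg_mem' := fun {a} ha => by
        simp only [mem_ofPred_eq, Circle.exp_neg] at *
        exact hcluster _ ha _ (by simpa using mapClusterPt_self_zpow_atTop_pow (Circle.exp a) (-1)) }
  have hG : ∀ s, s ∈ G ↔ Circle.exp s ∈ H := fun s => Iff.rfl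
  have hGcl : IsClosed (G : Set ℝ) := hcl.preimage Circle.exp.continuous
  rcases G.dense_or_cyclic with hd | ⟨a, ha⟩
  · left
    refine eq_univ_of_forall fun ζ => ?_
    obtain ⟨s, rfl⟩ := Circle.exp_surjective ζ
    rw [← hG, ← SetLike.mem_coe, ← hGcl.closure_eq]
    exact hd s
  · right
    rw [← AddSubgroup.zmultiples_eq_closure] at ha
    have h2 : 2 * Real.pi ∈ G := by
      rw [hG, Circle.exp_two_pi]
      exact hcluster a₀ ha₀ 1 (mapClusterPt_one_atTop_pow a₀)
    rw [ha, AddSubgroup.mem_zmultiples_iff] at h2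
    obtain ⟨m, hm⟩ := h2
    rw [zsmul_eq_mul] at hm
    have hpi := Real.pi_pos
    have hm0 : m ≠ 0 := by
      rintro rfl
      simp at hm
    have hpowz : ∀ ζ : Circle, ζ ^ m.natAbs = 1 ↔ ζ ^ m = 1 := by
      intro ζ
      rw [pow_natAbs_eq_one]
    refine ⟨m.natAbs, Int.natAbs_pos.2 hm0, fun ζ => ?_⟩
    obtain ⟨s, rfl⟩ := Circle.exp_surjective ζ
    rw [hpowz, ← hG, ha, AddSubgroup.mem_zmultiples_iff, ← Circle.exp_zsmul, Circle.exp_eq_one]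
    have hmR : (m : ℝ) ≠ 0 := by exact_mod_cast hm0
    constructor
    · rintro ⟨j, rfl⟩
      refine ⟨j, ?_⟩
      rw [← hm]; simp only [zsmul_eq_mul]; ring
    · rintro ⟨j, hj⟩
      refine ⟨j, ?_⟩
      rw [← hm] at hj; simp only [zsmul_eq_mul] at hj ⊢
      apply mul_left_cancel₀ hmR
      rw [hj]; ring

/-! ### The punctured orbit span -/

section OrbitSpan

variable {X : Type*} [NormedAddCommGroup X] [NormedSpace ℂ X]

/-- The topology on nonzero polynomials given by the distances between the vectors `q(T) x`. -/
noncomputable abbrev orbitTopology (T : X →L[ℂ] X) (x : X) :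
    TopologicalSpace (nonZeroDivisors ℂ[X]) :=
  TopologicalSpace.induced (fun q => aeval T (q : ℂ[X]) x) UniformSpace.toTopologicalSpace

theorem contractibleSpace_orbitTopology (T : X →L[ℂ] X) (x : X) :
    @ContractibleSpace _ (orbitTopology T x) := by
  let _ := orbitTopology T x
  have hev : Continuous fun q : nonZeroDivisors ℂ[X] => aeval T (q : ℂ[X]) x :=
    continuous_induced_dom
  have hne₁ : ∀ (s : ℝ) (q : nonZeroDivisors ℂ[X]),
      (C ((1 - s : ℝ) : ℂ) + C (s : ℂ) * Polynomial.X) * (q : ℂ[X]) ∈ nonZeroDivisors ℂ[X] := by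
    intro s q
    refine mul_mem (mem_nonZeroDivisors_of_ne_zero fun h => ?_) q.2
    have h0 := congrArg (coeff · 0) h
    have h1 := congrArg (coeff · 1) h
    simp only [coeff_add, coeff_C_zero, coeff_C_mul, coeff_X_zero, coeff_X_one, coeff_C_succ,
      coeff_zero, mul_zero, mul_one, add_zero, zero_add, Complex.ofReal_eq_zero] at h0 h1
    linarith
  have hne₂ : ∀ (s : ℝ) (q : nonZeroDivisors ℂ[X]),
      C ((1 - s : ℝ) : ℂ) * Polynomial.X * (q : ℂ[X]) + C (s : ℂ) ∈ nonZeroDivisors ℂ[X] := by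
    intro s q
    refine mem_nonZeroDivisors_of_ne_zero fun h => ?_
    have h0 := congrArg (coeff · 0) h
    simp [mul_assoc] at h0
    simp [h0, nonZeroDivisors.coe_ne_zero] at h
  let mulX : C(nonZeroDivisors ℂ[X], nonZeroDivisors ℂ[X]) :=
    ⟨fun q => ⟨(Polynomial.X : ℂ[X]) * (q : ℂ[X]),
      mul_mem (mem_nonZeroDivisors_of_ne_zero X_ne_zero) q.2⟩, by
      refine continuous_induced_rng.2 ?_
      simp only [comp_def, map_mul, aeval_X, mul_apply_eq_comp]
      exact T.continuous.comp hev⟩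
  rw [contractible_iff_id_nullhomotopic]
  have H₁ : (ContinuousMap.id _).Homotopic mulX := ⟨
    { toFun := fun p => ⟨_, hne₁ p.1 p.2⟩
      continuous_toFun := by
        refine continuous_induced_rng.2 ?_
        simp only [comp_def, map_mul, map_add, aeval_X, aeval_C, mul_apply_eq_comp,
          Algebra.algebraMap_eq_smul_one, add_apply,
          smul_apply, one_apply_eq_self]
        have he : Continuous fun p : unitInterval × nonZeroDivisors ℂ[X] =>
            aeval T (p.2 : ℂ[X]) x := hev.comp continuous_snd
        fun_prop
      map_zero_left := fun q => Subtype.ext (by simp)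
      map_one_left := fun q => Subtype.ext (by simp [mulX]) }⟩
  have H₂ : mulX.Homotopic (ContinuousMap.const _ 1) := ⟨
    { toFun := fun p => ⟨_, hne₂ p.1 p.2⟩
      continuous_toFun := by
        refine continuous_induced_rng.2 ?_
        simp only [comp_def, map_mul, map_add, aeval_X, aeval_C, mul_apply_eq_comp,
          Algebra.algebraMap_eq_smul_one, add_apply,
          smul_apply, one_apply_eq_self]
        have he : Continuous fun p : unitInterval × nonZeroDivisors ℂ[X] =>
            aeval T (p.2 : ℂ[X]) x := hev.comp continuous_snd
        fun_prop
      map_zero_left := fun q => Subtype.ext (by simp [mulX])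
      map_one_left := fun q => Subtype.ext (by simp) }⟩
  exact ⟨1, H₁.trans H₂⟩

end OrbitSpan

/-! ### Operators with phases -/

section Phase

variable {X : Type*} [NormedAddCommGroup X] [NormedSpace ℂ X] {ι : Type*}

/-- A family `S` of operators commuting with `T`, multiplicative for an operation `op` on the
indices, with phases `u` that are asymptotically multiplicative along the filter `F`. -/
structure PhasedAction (T : X →L[ℂ] X) (F : Filter ι) (op : ι → ι → ι) (S : ι → X →L[ℂ] X)
    (u : ι → Circle) : Prop where
  commute : ∀ i, Commute (S i) T
  map_op : ∀ i j, S (op i j) = S i * S j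
  tendsto_op : Tendsto (uncurry op) (F.curry F) F
  phase_op : ∀ i, Tendsto (fun j => u (op i j) / (u i * u j)) F (𝓝 1)

/-- `F`-orbits of `x` under `S` accumulate everywhere. -/
def IsUniversalAlong (F : Filter ι) (S : ι → X →L[ℂ] X) (x : X) : Prop :=
  ∀ z, MapClusterPt z F fun i => S i x

/-- `S i y` accumulates at `z` while the phase accumulates at `ζ`. -/
def PhaseRel (F : Filter ι) (S : ι → X →L[ℂ] X) (u : ι → Circle) (y z : X) (ζ : Circle) : Prop :=
  MapClusterPt (z, ζ) F fun i => (S i y, u i)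

variable {T : X →L[ℂ] X} {F : Filter ι} {op : ι → ι → ι} {S : ι → X →L[ℂ] X} {u : ι → Circle}
  {x y z w : X} {ζ ξ : Circle}

theorem isClosed_phaseRel : IsClosed {p : X × Circle | PhaseRel F S u y p.1 p.2} :=
  isClosed_setOfPred_clusterPt

theorem IsUniversalAlong.exists_phaseRel (hy : IsUniversalAlong F S y) (z : X) :
    ∃ ζ, PhaseRel F S u y z ζ := by
  obtain ⟨U, hU, hz⟩ := mapClusterPt_iff_ultrafilter.1 (hy z)
  obtain ⟨ζ, -, hζ⟩ := isCompact_univ.ultrafilter_le_nhds (U.map u) (by simp)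
  exact ⟨ζ, mapClusterPt_iff_ultrafilter.2 ⟨U, hU, hz.prodMk_nhds hζ⟩⟩

theorem PhaseRel.map_clm (h : PhaseRel F S u y z ζ) {R : X →L[ℂ] X} (hR : ∀ i, Commute (S i) R) :
    PhaseRel F S u (R y) (R z) ζ := by
  have hc : ContinuousAt (fun p : X × Circle => (R p.1, p.2)) (z, ζ) := by fun_prop
  have := MapClusterPt.continuousAt_comp hc h
  refine this.congrFun (Eventually.of_forall fun i => ?_)
  have hi : S i (R y) = R (S i y) := congrArg (fun A : X →L[ℂ] X => A y) (hR i)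
  simp [hi]

theorem PhasedAction.trans (hA : PhasedAction T F op S u) (h₁ : PhaseRel F S u y z ζ)
    (h₂ : PhaseRel F S u z w ξ) : PhaseRel F S u y w (ζ * ξ) := by
  rw [PhaseRel, mapClusterPt_iff_frequently]
  intro N hN
  rw [frequently_iff]
  intro U hU
  obtain ⟨W, hW, N', hN', hsub⟩ := mem_nhds_prod_iff.1 hN
  have hop : ∀ᶠ i in F, ∀ᶠ j in F, op i j ∈ U :=
    eventually_curry_iff.1 (hA.tendsto_op.eventually_mem hU)
  have hphase : ∀ᶠ b in 𝓝 ξ, ∀ᶠ a in 𝓝 (1 : Circle) ×ˢ 𝓝 ζ, a.1 * (b * a.2) ∈ N' := by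
    have hc : ContinuousAt (fun p : Circle × (Circle × Circle) => p.2.1 * (p.1 * p.2.2))
        (ξ, (1, ζ)) := by fun_prop
    have : ∀ᶠ p : Circle × (Circle × Circle) in 𝓝 (ξ, (1, ζ)), p.2.1 * (p.1 * p.2.2) ∈ N' :=
      hc.eventually (by simpa [mul_comm ξ] using hN')
    rw [nhds_prod_eq, nhds_prod_eq] at this
    exact this.curry
  obtain ⟨i, ⟨hiW, hiN⟩, hiU⟩ :=
    ((h₂.frequently (p := fun p => p.1 ∈ interior W ∧
      ∀ᶠ a in 𝓝 (1 : Circle) ×ˢ 𝓝 ζ, a.1 * (p.2 * a.2) ∈ N')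
      (by
        rw [nhds_prod_eq]
        exact Eventually.prod_mk (pa := fun a => a ∈ interior W) (interior_mem_nhds.2 hW)
          hphase)).and_eventually hop).exists
  have hSi : ∀ᶠ y' in 𝓝 z, S i y' ∈ W :=
    (S i).continuous.continuousAt.eventually (mem_interior_iff_mem_nhds.1 hiW)
  obtain ⟨V₁, hV₁, V₂, hV₂, hV⟩ := mem_prod_iff.1 hiN
  obtain ⟨j, ⟨hjW, hjV⟩, hjU, hjph⟩ :=
    ((h₁.frequently (p := fun p => S i p.1 ∈ W ∧ p.2 ∈ V₂)
      (by
        rw [nhds_prod_eq]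
        exact hSi.prod_mk hV₂)).and_eventually
      (hiU.and ((hA.phase_op i).eventually_mem hV₁))).exists
  refine ⟨op i j, hjU, hsub ⟨?_, ?_⟩⟩
  · simpa [hA.map_op] using hjW
  · have := hV (Set.mk_mem_prod hjph hjV)
    simpa using this

theorem PhasedAction.commute_aeval (hA : PhasedAction T F op S u) (q : ℂ[X]) (i : ι) :
    Commute (S i) (aeval T q) := by
  induction q using Polynomial.induction_on' with
  | add p q hp hq => rw [map_add]; exact hp.add_right hq
  | monomial n a =>
    rw [aeval_monomial]
    exact (Algebra.commute_algebraMap_right a _).mul_right ((hA.commute i).pow_right n)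

theorem PhasedAction.isUniversalAlong_aeval (hA : PhasedAction T F op S u)
    (hx : IsUniversalAlong F S x) {q : ℂ[X]} (hq : DenseRange (aeval T q)) :
    IsUniversalAlong F S (aeval T q x) := by
  have hcl : IsClosed {z : X | MapClusterPt z F fun i => S i (aeval T q x)} :=
    isClosed_setOfPred_clusterPt
  intro z
  refine hq.induction_on (p := fun z => MapClusterPt z F fun i => S i (aeval T q x)) z hcl ?_
  intro y
  have hc : ContinuousAt (aeval T q) y := by fun_prop
  have := MapClusterPt.continuousAt_comp hc (hx y)
  refine this.congrFun (Eventually.of_forall fun i => ?_)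
  exact (congrArg (fun A : X →L[ℂ] X => A x) (hA.commute_aeval q i)).symm

/-- Either the phase can be prescribed to be `1`, or the phase relation on the orbit span is
governed by a continuous real-valued character. -/
theorem PhasedAction.phaseRel_one_or_exists_character (hA : PhasedAction T F op S u)
    (hx : IsUniversalAlong F S x) (hd : ∀ q : ℂ[X], q ≠ 0 → DenseRange (aeval T q)) :
    (∀ z, PhaseRel F S u x z 1) ∨
    ∃ k : ℕ, 1 ≤ k ∧ (∀ ζ : Circle, PhaseRel F S u x x ζ ↔ ζ ^ k = 1) ∧
      ∃ ψ : nonZeroDivisors ℂ[X] → ℝ,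
        (@Continuous _ _ (orbitTopology T x) _ ψ) ∧ (∀ q r, ψ (q * r) = ψ q + ψ r) ∧
        ∀ (q : nonZeroDivisors ℂ[X]) (ζ : Circle), PhaseRel F S u x (aeval T (q : ℂ[X]) x) ζ →
          ζ ^ k = Circle.exp (ψ q) := by
  let _ := orbitTopology T x
  have := contractibleSpace_orbitTopology T x
  have hev : Continuous fun q : nonZeroDivisors ℂ[X] => aeval T (q : ℂ[X]) x :=
    continuous_induced_dom
  have hHcl : IsClosed {ζ | PhaseRel F S u x x ζ} :=
    isClosed_phaseRel.preimage (f := fun ζ : Circle => (x, ζ)) (by fun_prop)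
  rcases circle_closed_subsemigroup (H := {ζ | PhaseRel F S u x x ζ}) (hx.exists_phaseRel x) hHcl
    (fun a ha b hb => hA.trans ha hb) with hH | ⟨k, hk1, hk⟩
  · left
    intro z
    obtain ⟨ζ, hζ⟩ := hx.exists_phaseRel (u := u) z
    have h1 : PhaseRel F S u x x ζ⁻¹ := by
      change ζ⁻¹ ∈ {ζ | PhaseRel F S u x x ζ}
      rw [hH]; trivial
    simpa using hA.trans h1 hζ
  right
  have hk' : ∀ ζ : Circle, PhaseRel F S u x x ζ ↔ ζ ^ k = 1 := hk
  refine ⟨k, hk1, hk', ?_⟩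
  choose a ha using fun q : nonZeroDivisors ℂ[X] =>
    hx.exists_phaseRel (u := u) (aeval T (q : ℂ[X]) x)
  have huniq : ∀ (q : nonZeroDivisors ℂ[X]) (ζ : Circle),
      PhaseRel F S u x (aeval T (q : ℂ[X]) x) ζ → ζ ^ k = a q ^ k := by
    intro q ζ hζ
    obtain ⟨ξ, hξ⟩ := (hA.isUniversalAlong_aeval hx
      (hd q (nonZeroDivisors.coe_ne_zero q))).exists_phaseRel (u := u) x
    have h1 := (hk' _).1 (hA.trans hζ hξ)
    have h2 := (hk' _).1 (hA.trans (ha q) hξ)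
    rw [mul_pow] at h1 h2
    exact mul_right_cancel (h1.trans h2.symm)
  have hmul : ∀ q r, a (q * r) ^ k = a q ^ k * a r ^ k := by
    intro q r
    rw [← mul_pow]
    refine (huniq _ _ ?_).symm
    have := hA.trans (ha q) ((ha r).map_clm (hA.commute_aeval q))
    simpa using this
  have hcont : Continuous fun q => a q ^ k := by
    rw [continuous_iff_isClosed]
    intro s hs
    have hcl : IsClosed {p : nonZeroDivisors ℂ[X] × Circle |
        PhaseRel F S u x (aeval T (p.1 : ℂ[X]) x) p.2 ∧ p.2 ^ k ∈ s} :=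
      (isClosed_phaseRel.preimage ((hev.comp continuous_fst).prodMk continuous_snd)).inter
        (hs.preimage (by fun_prop))
    convert isClosedMap_fst_of_compactSpace _ hcl using 1
    ext q
    constructor
    · intro hq
      exact ⟨(q, a q), ⟨ha q, hq⟩, rfl⟩
    · rintro ⟨⟨q, ζ⟩, ⟨h1, h2⟩, rfl⟩
      simpa [huniq q ζ h1] using h2
  have hmulc : ∀ q : nonZeroDivisors ℂ[X], Continuous fun r => q * r := by
    intro q
    refine continuous_induced_rng.2 ?_
    simp only [comp_def, Submonoid.coe_mul, map_mul, mul_apply_eq_comp]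
    exact (aeval T (q : ℂ[X])).continuous.comp hev
  obtain ⟨ψ, hψc, hψm, hψ⟩ := exists_continuous_additive_circleExp_lift hmulc _ hcont hmul
  exact ⟨ψ, hψc, hψm, fun q ζ h => by rw [hψ, huniq q ζ h]⟩

end Phase

/-! ### Rotations of the whole orbit -/

section Rotation

variable {X : Type*} [NormedAddCommGroup X] [NormedSpace ℂ X]

theorem phasedAction_rotation (T : X →L[ℂ] X) :
    PhasedAction T ⊤ (· * ·) (fun p : Circle × Multiplicative ℕ =>
      (p.1 : ℂ) • T ^ p.2.toAdd) Prod.fst where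
  commute i := ((Commute.refl T).pow_left _).smul_left _
  map_op i j := by simp [pow_add, smul_smul, mul_comm]
  tendsto_op := tendsto_top
  phase_op i := by simp

theorem mapClusterPt_top_iff {Y ι : Type*} [TopologicalSpace Y] {v : ι → Y} {y : Y} :
    MapClusterPt y ⊤ v ↔ y ∈ closure (range v) := by
  simp [MapClusterPt, map_top, mem_closure_iff_clusterPt]

theorem map_pow_eq_nsmul {M : Type*} [Monoid M] {ψ : M → ℝ}
    (hψ : ∀ a b, ψ (a * b) = ψ a + ψ b) (a : M) (n : ℕ) : ψ (a ^ n) = n * ψ a := by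
  have h1 : ψ 1 = 0 := by simpa using hψ 1 1
  induction n with
  | zero => simp [h1]
  | succ n ih => rw [pow_succ, hψ, ih]; push_cast; ring

/-- A dense orbit up to unimodular rotations is dense without them. -/
theorem dense_orbit_of_dense_rotatedOrbit {T : X →L[ℂ] X} {x : X}
    (hx : Dense (rotatedOrbit T x)) : Dense (range fun n : ℕ => (T ^ n) x) := by
  have hA := phasedAction_rotation T
  have hu : IsUniversalAlong ⊤ (fun p : Circle × Multiplicative ℕ =>
      (p.1 : ℂ) • T ^ p.2.toAdd) x := fun z => mapClusterPt_top_iff.2 (hx z)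
  rcases hA.phaseRel_one_or_exists_character hu
    (fun q hq => denseRange_aeval_of_dense_rotatedOrbit hx hq) with h | ⟨k, hk, -, ψ, hψc, hψm, hψ⟩
  · intro y
    have hc : ContinuousAt (fun p : X × Circle => ((p.2⁻¹ : Circle) : ℂ) • p.1) (y, 1) := by fun_prop
    have := mapClusterPt_top_iff.1 (MapClusterPt.continuousAt_comp hc (h y))
    simp only [inv_one, Circle.coe_one, one_smul] at this
    refine closure_mono ?_ this
    rintro _ ⟨p, rfl⟩
    exact ⟨p.2.toAdd, by simp [smul_smul]⟩
  · exfalso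
    let _ := orbitTopology T x
    let c : Circle →* nonZeroDivisors ℂ[X] :=
      { toFun := fun a => ⟨C (a : ℂ), mem_nonZeroDivisors_of_ne_zero (by simp)⟩
        map_one' := Subtype.ext (by simp)
        map_mul' := fun a b => Subtype.ext (by simp) }
    have hc : Continuous c := by
      refine continuous_induced_rng.2 ?_
      simp only [comp_def, c, MonoidHom.coe_mk, OneHom.coe_mk, aeval_C,
        Algebra.algebraMap_eq_smul_one, smul_apply, one_apply_eq_self]
      fun_prop
    obtain ⟨B, hB⟩ := (isCompact_range (hψc.comp hc)).isBounded.exists_norm_le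
    have hzero : ∀ a, ψ (c a) = 0 := by
      intro a
      by_contra hne
      obtain ⟨n, hn⟩ := exists_nat_gt (B / |ψ (c a)|)
      have h1 := hB _ ⟨a ^ n, rfl⟩
      rw [comp_apply, map_pow, map_pow_eq_nsmul hψm, norm_mul, Real.norm_natCast,
        Real.norm_eq_abs] at h1
      exact absurd h1 (not_le.2 ((div_lt_iff₀ (abs_pos.2 hne)).1 hn))
    have hpow : ∀ a : Circle, a ^ k = 1 := by
      intro a
      rw [hψ (c a) a, hzero, Circle.exp_zero]
      refine mapClusterPt_top_iff.2 (subset_closure ⟨(a, 1), ?_⟩)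
      simp [c, Algebra.algebraMap_eq_smul_one]
    have h2 := hpow (Circle.exp (Real.pi / k))
    rw [← Circle.exp_nsmul] at h2
    have hk0 : (k : ℝ) ≠ 0 := by positivity
    rw [nsmul_eq_mul, mul_div_cancel₀ _ hk0] at h2
    have := congrArg (fun z : Circle => (z : ℂ).re) h2
    norm_num [Circle.coe_exp] at this

end Rotation

/-! ### Refining filters along which the orbit is universal -/

section UniversalFilter

variable {X : Type*} [NormedAddCommGroup X] [NormedSpace ℂ X]

/-- An additively idempotent filter at infinity along which the orbit of `x` accumulates
everywhere. -/
structure IsUniversalFilter (T : X →L[ℂ] X) (x : X) (F : Filter ℕ) : Prop where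
  le_atTop : F ≤ atTop
  tendsto_add : Tendsto (uncurry (· + ·)) (F.curry F) F
  isUniversalAlong : IsUniversalAlong F (fun n => T ^ n) x

variable {T : X →L[ℂ] X} {x : X} {F : Filter ℕ}

theorem IsUniversalFilter.dense (hF : IsUniversalFilter T x F) :
    Dense (range fun n : ℕ => (T ^ n) x) := fun z =>
  mapClusterPt_top_iff.1 ((hF.isUniversalAlong z).mono le_top)

theorem IsUniversalFilter.phasedAction (hF : IsUniversalFilter T x F) {u : ℕ → Circle}
    (hu : ∀ n, Tendsto (fun m => u (n + m) / (u n * u m)) F (𝓝 1)) :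
    PhasedAction T F (· + ·) (fun n => T ^ n) u where
  commute i := (Commute.refl T).pow_left i
  map_op i j := pow_add T i j
  tendsto_op := hF.tendsto_add
  phase_op := hu

theorem orbit_subset_rotatedOrbit (T : X →L[ℂ] X) (x : X) :
    (range fun n : ℕ => (T ^ n) x) ⊆ rotatedOrbit T x := by
  rintro _ ⟨n, rfl⟩
  exact ⟨(1, n), by simp⟩

theorem IsUniversalFilter.phaseRel_one (hF : IsUniversalFilter T x F) {u : ℕ → Circle}
    (hu : ∀ n, Tendsto (fun m => u (n + m) / (u n * u m)) F (𝓝 1)) (z : X) :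
    PhaseRel F (fun n => T ^ n) u x z 1 := by
  have hA := hF.phasedAction hu
  have hdense := hF.dense
  rcases hA.phaseRel_one_or_exists_character hF.isUniversalAlong
    (fun q hq => denseRange_aeval_of_dense_rotatedOrbit
      (hdense.mono (orbit_subset_rotatedOrbit T x)) hq) with
    h | ⟨k, -, hxx, ψ, hψc, hψm, hψ⟩
  · exact h z
  let _ := orbitTopology T x
  have hind : IsInducing fun q : nonZeroDivisors ℂ[X] => aeval T (q : ℂ[X]) x := ⟨rfl⟩
  let t : nonZeroDivisors ℂ[X] := ⟨Polynomial.X, mem_nonZeroDivisors_of_ne_zero X_ne_zero⟩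
  have ht : ∀ n : ℕ, aeval T ((t ^ n : nonZeroDivisors ℂ[X]) : ℂ[X]) x = (T ^ n) x := by
    intro n
    simp [t]
  have hψ1 : ψ 1 = 0 := by simpa using hψm 1 1
  have hψt : ψ t = 0 := by
    by_contra hne
    have hnhds : ∀ᶠ q in 𝓝 (1 : nonZeroDivisors ℂ[X]), |ψ q| < |ψ t| :=
      (hψc.abs.tendsto 1).eventually_lt_const (by simpa [hψ1] using hne)
    rw [hind.nhds_eq_comap, eventually_comap] at hnhds
    have hnhds' : ∀ᶠ y in 𝓝 x, ∀ q : nonZeroDivisors ℂ[X],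
        aeval T (q : ℂ[X]) x = y → |ψ q| < |ψ t| := by simpa using hnhds
    obtain ⟨n, hn, hn1⟩ := (((hF.isUniversalAlong x).frequently hnhds').and_eventually
      (hF.le_atTop (eventually_ge_atTop 1))).exists
    have h1 := hn (t ^ n) (ht n)
    rw [map_pow_eq_nsmul hψm, abs_mul, Nat.abs_cast] at h1
    have h2 : (1 : ℝ) ≤ n := by exact_mod_cast hn1
    nlinarith [abs_nonneg (ψ t)]
  have hψ0 : ∀ n : ℕ, ψ (t ^ n) = 0 := fun n => by rw [map_pow_eq_nsmul hψm, hψt, mul_zero]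
  have horbit : ∀ n : ℕ, PhaseRel F (fun n => T ^ n) u x ((T ^ n) x) 1 := by
    intro n
    obtain ⟨ζ, hζ⟩ := hF.isUniversalAlong.exists_phaseRel (u := u) ((T ^ n) x)
    have h1 : ζ ^ k = 1 := by
      rw [hψ (t ^ n) ζ (by rwa [ht]), hψ0, Circle.exp_zero]
    have h2 : PhaseRel F (fun n => T ^ n) u x x ζ⁻¹ := (hxx _).2 (by rw [inv_pow, h1, inv_one])
    simpa using hA.trans h2 hζ
  have hcl : IsClosed {z : X | PhaseRel F (fun n => T ^ n) u x z 1} :=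
    isClosed_phaseRel.preimage (f := fun z : X => (z, (1 : Circle))) (by fun_prop)
  exact hdense.induction (by rintro _ ⟨n, rfl⟩; exact horbit n) hcl z

/-- A universal filter can be refined so that an asymptotically multiplicative phase tends
to `1`. -/
theorem IsUniversalFilter.inf_comap (hF : IsUniversalFilter T x F) {u : ℕ → Circle}
    (hu : ∀ n, Tendsto (fun m => u (n + m) / (u n * u m)) F (𝓝 1)) :
    IsUniversalFilter T x (F ⊓ comap u (𝓝 1)) where
  le_atTop := inf_le_left.trans hF.le_atTop
  tendsto_add := by
    refine tendsto_inf.2 ⟨fun s hs => eventually_curry_iff.2 <|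
      ((eventually_curry_iff.1 (hF.tendsto_add.eventually_mem hs)).filter_mono inf_le_left).mono
        fun i hi => hi.filter_mono inf_le_left, ?_⟩
    rw [tendsto_comap_iff]
    intro N hN
    rw [mem_map]
    have hc : ContinuousAt (fun p : Circle × Circle × Circle => p.2.2 * (p.1 * p.2.1))
        (1, 1, 1) := by fun_prop
    have h1 : ∀ᶠ p : Circle × Circle × Circle in 𝓝 (1, 1, 1), p.2.2 * (p.1 * p.2.1) ∈ N :=
      hc.eventually (by simpa using hN)
    rw [nhds_prod_eq] at h1
    refine eventually_curry_iff.2 ?_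
    have hi : ∀ᶠ i in F ⊓ comap u (𝓝 1), ∀ᶠ p : Circle × Circle in 𝓝 (1, 1),
        p.2 * (u i * p.1) ∈ N := (tendsto_comap.mono_left inf_le_right).eventually h1.curry
    filter_upwards [hi] with i hi
    rw [nhds_prod_eq] at hi
    have h2 : Tendsto (fun j => (u j, u (i + j) / (u i * u j))) (F ⊓ comap u (𝓝 1))
        (𝓝 1 ×ˢ 𝓝 1) :=
      (tendsto_comap.mono_left inf_le_right).prodMk ((hu i).mono_left inf_le_left)
    filter_upwards [h2.eventually hi] with j hj
    simpa using hj
  isUniversalAlong z := by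
    rw [mapClusterPt_iff_ultrafilter]
    obtain ⟨U, hU, hz⟩ := mapClusterPt_iff_ultrafilter.1 (hF.phaseRel_one hu z)
    rw [nhds_prod_eq, tendsto_prod_iff'] at hz
    exact ⟨U, le_inf hU hz.2.le_comap, hz.1⟩

/-- The successive quotients of a sequence in the circle. -/
noncomputable def circleRatio (c : ℕ → Circle) (n : ℕ) : Circle := c (n + 1) / c n

theorem IsUniversalFilter.exists_refinement_of_iterate_circleRatio_eq_one
    (k : ℕ) (c : ℕ → Circle) (hc : circleRatio^[k] c = 1) (hF : IsUniversalFilter T x F) :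
    ∃ F' ≤ F, IsUniversalFilter T x F' ∧
      ∀ i, Tendsto (fun m => c (i + m)) F' (𝓝 (c i)) := by
  induction k generalizing c with
  | zero =>
    have hc1 : c = 1 := hc
    exact ⟨F, le_rfl, hF, fun i => by simpa [hc1] using tendsto_const_nhds⟩
  | succ k ih =>
    obtain ⟨F', hle, hF', hlim⟩ := ih (circleRatio c) hc
    have hquot : ∀ n, Tendsto (fun m => c (n + m) / c m) F' (𝓝 (c n / c 0)) := by
      intro n
      induction n with
      | zero => simpa using tendsto_const_nhds
      | succ n ihn =>
        have := (hlim n).mul ihn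
        simp only [circleRatio] at this
        convert this using 2
        · simp [Nat.add_right_comm]
        · simp
    let w : ℕ → Circle := fun n => c n / c 0
    have hw : ∀ n, Tendsto (fun m => w (n + m) / (w n * w m)) F' (𝓝 1) := by
      intro n
      have := (hquot n).div_const' (c n / c 0)
      rw [div_self'] at this
      refine this.congr fun m => ?_
      simp only [w]
      rw [mul_comm, ← div_div]
      simp
    refine ⟨_, inf_le_left.trans hle, hF'.inf_comap hw, fun i => ?_⟩
    have h0 : Tendsto w (F' ⊓ comap w (𝓝 1)) (𝓝 1) := tendsto_comap.mono_left inf_le_right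
    have h1 := (((hquot i).mono_left inf_le_left).mul h0).mul_const (c 0)
    simpa [w] using h1

end UniversalFilter

/-! ### Phases with asymptotically vanishing iterated differences -/

section Main

variable {X : Type*} [NormedAddCommGroup X] [NormedSpace ℂ X]

theorem isUniversalFilter_atTop [Nontrivial X] {T : X →L[ℂ] X} {x : X}
    (hx : Dense (range fun n : ℕ => (T ^ n) x)) : IsUniversalFilter T x atTop where
  le_atTop := le_rfl
  tendsto_add := by
    intro s hs
    refine eventually_curry_iff.2 (Eventually.of_forall fun i => ?_)
    exact (tendsto_atTop_mono (fun j => Nat.le_add_left j i) tendsto_id).eventually_mem hs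
  isUniversalAlong z := by
    have := Module.punctured_nhds_neBot ℂ X
    rw [mapClusterPt_iff_frequently]
    intro N hN
    rw [frequently_atTop]
    intro m
    have h := hx.sdiff_finite (Set.toFinite ((fun n : ℕ => (T ^ n) x) '' Set.Iio m))
    obtain ⟨_, hyN, ⟨n, rfl⟩, hn⟩ := mem_closure_iff_nhds.1 (h z) N hN
    exact ⟨n, not_lt.1 fun hlt => hn ⟨n, hlt, rfl⟩, hyN⟩

theorem tendsto_iterate_circleRatio {ι : Type*} {l : Filter ι} {v : ι → ℕ → Circle}
    {c : ℕ → Circle} (h : ∀ i, Tendsto (fun n => v n i) l (𝓝 (c i))) (k i : ℕ) :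
    Tendsto (fun n => circleRatio^[k] (v n) i) l (𝓝 (circleRatio^[k] c i)) := by
  induction k generalizing v c with
  | zero => exact h i
  | succ k ih => exact ih (v := fun n => circleRatio (v n)) fun j => (h (j + 1)).div' (h j)

theorem iterate_circleRatio_shift (u : ℕ → Circle) (k n i : ℕ) :
    circleRatio^[k] (fun j => u (j + n)) i = circleRatio^[k] u (i + n) := by
  induction k generalizing u with
  | zero => rfl
  | succ k ih =>
    rw [iterate_succ_apply, iterate_succ_apply, ← ih]
    refine congrFun (congrArg _ (funext fun j => ?_)) i
    simp [circleRatio, Nat.add_right_comm]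

/-- If iterated quotients of the phase tend to `1`, then multiplying a dense orbit by the phase
keeps it dense. -/
theorem dense_smul_orbit [Nontrivial X] {T : X →L[ℂ] X} {x : X}
    (hx : Dense (range fun n : ℕ => (T ^ n) x)) {u : ℕ → Circle} {k : ℕ}
    (hu : Tendsto (circleRatio^[k] u) atTop (𝓝 1)) (m₀ : ℕ) :
    Dense ((fun n => (u n : ℂ) • (T ^ n) x) '' Set.Ici m₀) := by
  have hF := isUniversalFilter_atTop hx
  obtain ⟨U, hU, hUx⟩ := mapClusterPt_iff_ultrafilter.1 (hF.isUniversalAlong x)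
  choose c _ hc using fun i =>
    isCompact_univ.ultrafilter_le_nhds (U.map fun n => u (i + n)) (by simp)
  have hc' : ∀ i, Tendsto (fun n => u (i + n)) U (𝓝 (c i)) := hc
  have hc1 : circleRatio^[k] c = 1 := by
    funext i
    refine tendsto_nhds_unique (tendsto_iterate_circleRatio (v := fun n j => u (j + n)) hc' k i) ?_
    simp only [iterate_circleRatio_shift]
    exact (hu.comp (tendsto_atTop_mono (fun n => Nat.le_add_left n i) tendsto_id)).mono_left hU
  obtain ⟨F, -, hFu, hFc⟩ := hF.exists_refinement_of_iterate_circleRatio_eq_one k c hc1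
  have hc0 : Tendsto c F (𝓝 (c 0)) := by simpa using hFc 0
  have hmem : ∀ y, (c 0 : ℂ) • y ∈ closure ((fun n => (u n : ℂ) • (T ^ n) x) '' Set.Ici m₀) := by
    intro y
    obtain ⟨V, hV, hVy⟩ := mapClusterPt_iff_ultrafilter.1 (hFu.isUniversalAlong y)
    have h1 : Tendsto (fun m => (c m : ℂ) • (T ^ m) x) V (𝓝 ((c 0 : ℂ) • y)) :=
      (hc0.mono_left hV).smul hVy
    refine isClosed_closure.mem_of_tendsto h1 (Eventually.of_forall fun m => ?_)
    have h2 : Tendsto (fun n => (u (m + n) : ℂ) • (T ^ (m + n)) x) U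
        (𝓝 ((c m : ℂ) • (T ^ m) x)) := by
      simp only [pow_add, mul_apply_eq_comp]
      exact (hc' m).smul (((T ^ m).continuous.tendsto x).comp hUx)
    refine mem_closure_of_tendsto h2 ?_
    filter_upwards [hU (eventually_ge_atTop m₀)] with n hn
    exact ⟨m + n, le_add_left hn, rfl⟩
  intro z
  have := hmem (((c 0)⁻¹ : Circle) • z)
  rwa [Circle.smul_def, smul_smul, ← Circle.coe_mul, mul_inv_cancel, Circle.coe_one,
    one_smul] at this

theorem iterate_circleRatio_circleExp (f : ℕ → ℝ) (k : ℕ) :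
    circleRatio^[k] (fun n => Circle.exp (f n)) = fun n => Circle.exp ((fwdDiff 1)^[k] f n) := by
  induction k generalizing f with
  | zero => rfl
  | succ k ih =>
    rw [iterate_succ_apply, iterate_succ_apply, ← ih]
    congr 1
    funext n
    simp [circleRatio, fwdDiff, Circle.exp_sub]

/-- A sequence whose increments are polynomial of degree at most `d` up to a vanishing error has
vanishing differences of order `d + 1`. -/
theorem tendsto_iterate_fwdDiff (f : ℕ → ℝ) (d : ℕ) (g : ℕ → ℕ → ℝ) (ε : ℕ → ℕ → ℝ)
    (hf : ∀ n k : ℕ, 1 ≤ n → 1 ≤ k →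
      f (n + k) - f n = (∑ l ∈ Finset.range (d + 1), g l n * (k : ℝ) ^ l) + ε k n)
    (hε : ∀ k : ℕ, 1 ≤ k → Tendsto (fun n => |ε k n|) atTop (𝓝 0)) :
    Tendsto ((fwdDiff 1)^[d + 1] f) atTop (𝓝 0) := by
  have key : ∀ n, 1 ≤ n → (fwdDiff 1)^[d + 1] f (n + 1) =
      ∑ j ∈ Finset.range (d + 1 + 1), ((-1 : ℤ) ^ (d + 1 - j) * (d + 1).choose j) • ε (j + 1) n := by
    intro n hn
    have hpoly : (fwdDiff 1)^[d + 1]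
        (fun r : ℝ => ∑ l ∈ Finset.range (d + 1), g l n * r ^ l) 1 = 0 := by
      rw [fwdDiff_iter_sum_mul_pow_eq_zero]
      rfl
    have hconst : (fwdDiff 1)^[d + 1] (fun _ : ℝ => f n) 1 = 0 := by
      have := fwdDiff_iter_sum_mul_pow_eq_zero (R := ℝ) (n := d + 1)
        (fun l => if l = 0 then f n else 0)
      simpa using congrFun this 1
    rw [fwdDiff_iter_eq_sum_shift] at hpoly hconst ⊢
    have : ∀ j, f (n + 1 + j • 1) = f n + (∑ l ∈ Finset.range (d + 1), g l n * (1 + j • 1 : ℝ) ^ l)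
        + ε (j + 1) n := by
      intro j
      have := hf n (j + 1) hn (Nat.le_add_left 1 j)
      rw [show n + 1 + j • 1 = n + (j + 1) by simp; ring, eq_add_of_sub_eq this]
      push_cast
      simp [add_comm, add_left_comm]
    simp only [this, smul_add, Finset.sum_add_distrib, hpoly, hconst, zero_add]
  refine (tendsto_add_atTop_iff_nat 1).1 ?_
  have hlim : Tendsto (fun n => ∑ j ∈ Finset.range (d + 1 + 1),
      ((-1 : ℤ) ^ (d + 1 - j) * (d + 1).choose j) • ε (j + 1) n) atTop (𝓝 0) := by
    rw [← Finset.sum_const_zero (s := Finset.range (d + 1 + 1))]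
    refine tendsto_finsetSum _ fun j _ => ?_
    have h := ((tendsto_zero_iff_abs_tendsto_zero _).2 (hε (j + 1) (Nat.le_add_left 1 j))).const_smul
      ((-1 : ℤ) ^ (d + 1 - j) * (d + 1).choose j)
    simpa using h
  refine hlim.congr' ?_
  filter_upwards [eventually_ge_atTop 1] with n hn
  exact (key n hn).symm

end Main

end Hypercyclicity

/-- Let `X` be a complex Banach space, `T` a bounded linear operator
on `X`, `x ∈ X`, and `(f(n))` a sequence of reals such that there are `d ≥ 0`,
sequences `(g_l(n))` for `0 ≤ l ≤ d` and `(ε_k(n))` for `k ≥ 1` with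
`f(n+k) − f(n) = ∑_{l=0}^{d} g_l(n) k^l + ε_k(n)` for all `n, k ≥ 1`, and
`|ε_k(n)| → 0` as `n → ∞` for each fixed `k ≥ 1`. Then `x` is hypercyclic for `T`
iff `{e^{i f(n)} T^n x : n ≥ 1}` is dense in `X`. -/
theorem stmt14 {X : Type*} [NormedAddCommGroup X] [NormedSpace ℂ X] [CompleteSpace X]
    (T : X →L[ℂ] X) (x : X) (f : ℕ → ℝ) (d : ℕ)
    (g : ℕ → ℕ → ℝ) (ε : ℕ → ℕ → ℝ)
    (hf : ∀ n k : ℕ, 1 ≤ n → 1 ≤ k →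
      f (n + k) - f n = (∑ l ∈ Finset.range (d + 1), g l n * (k : ℝ) ^ l) + ε k n)
    (hε : ∀ k : ℕ, 1 ≤ k → Tendsto (fun n => |ε k n|) atTop (nhds 0)) :
    Dense (Set.range fun n : ℕ => (T ^ n) x) ↔
      Dense {y : X | ∃ n : ℕ, 1 ≤ n ∧
        y = Complex.exp (Complex.I * Complex.ofReal (f n)) • (T ^ n) x} := by
  have hexp : ∀ n, Complex.exp (Complex.I * Complex.ofReal (f n)) = (Circle.exp (f n) : ℂ) := by
    intro n
    rw [Circle.coe_exp, mul_comm]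
  simp only [hexp]
  constructor
  · intro hx
    rcases subsingleton_or_nontrivial X with hX | hX
    · exact fun z => subset_closure ⟨1, le_rfl, Subsingleton.elim _ _⟩
    have hu : Tendsto (circleRatio^[d + 1] fun n => Circle.exp (f n)) atTop (𝓝 1) := by
      rw [iterate_circleRatio_circleExp, ← Circle.exp_zero]
      exact (Circle.exp.continuous.tendsto 0).comp (tendsto_iterate_fwdDiff f d g ε hf hε)
    refine (dense_smul_orbit hx hu 1).mono ?_
    rintro _ ⟨n, hn, rfl⟩
    exact ⟨n, hn, rfl⟩
  · intro hx
    refine dense_orbit_of_dense_rotatedOrbit (hx.mono ?_)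
    rintro _ ⟨n, -, rfl⟩
    exact ⟨(Circle.exp (f n), n), rfl⟩
end

section
/- Let T = 2B, where B is the unweighted backward shift on ℓ²(ℤ₊). There exists x ∈ HC(T) such that (e_0, 1) does not belong to the closure of the set {(T^n x, e^{i log n}) : n ≥ 1} in ℓ²(ℤ₊) × ℂ. -/
open Filter Topology

theorem separableSpace_lp_two : TopologicalSpace.SeparableSpace (lp (fun _ : ℕ => ℂ) 2) := by
  rw [← TopologicalSpace.isSeparable_univ_iff]
  have hs : TopologicalSpace.IsSeparable
      (Set.range fun n : ℕ => (lp.single 2 n (1 : ℂ) : lp (fun _ : ℕ => ℂ) 2)) :=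
    (Set.countable_range _).isSeparable
  refine (hs.span (R := ℂ)).closure.mono fun x _ => ?_
  refine mem_closure_of_tendsto (lp.hasSum_single (by simp) x) (Eventually.of_forall fun s => ?_)
  refine Submodule.sum_mem _ fun i _ => ?_
  have h : (lp.single 2 i (x i) : lp (fun _ : ℕ => ℂ) 2) = x i • lp.single 2 i (1 : ℂ) := by
    rw [← lp.single_smul]; simp
  rw [h]
  exact Submodule.smul_mem _ _ (Submodule.subset_span ⟨i, rfl⟩)

/-- The vectors of `ℓ²` whose support is contained in `A`. -/
def supportedIn (A : Set ℕ) : Submodule ℂ (lp (fun _ : ℕ => ℂ) 2) where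
  carrier := {x | ∀ n ∉ A, x n = 0}
  add_mem' hx hy n hn := by simp [hx n hn, hy n hn]
  zero_mem' n _ := by simp
  smul_mem' c x hx n hn := by simp [hx n hn]

theorem mem_supportedIn {A : Set ℕ} {x : lp (fun _ : ℕ => ℂ) 2} :
    x ∈ supportedIn A ↔ ∀ n ∉ A, x n = 0 := Iff.rfl

theorem continuous_lp_apply (n : ℕ) : Continuous fun x : lp (fun _ : ℕ => ℂ) 2 => x n :=
  (lp.evalCLM ℂ (fun _ : ℕ => ℂ) 2 n).continuous

theorem isClosed_supportedIn (A : Set ℕ) :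
    IsClosed (supportedIn A : Set (lp (fun _ : ℕ => ℂ) 2)) := by
  have h : (supportedIn A : Set (lp (fun _ : ℕ => ℂ) 2)) = ⋂ n ∈ Aᶜ, {x | x n = 0} := by
    ext x; simp [mem_supportedIn]
  rw [h]
  exact isClosed_biInter fun n _ => isClosed_eq (continuous_lp_apply n) continuous_const

theorem single_mem_supportedIn {A : Set ℕ} {k : ℕ} {a : ℂ} (h : k ∉ A → a = 0) :
    lp.single 2 k a ∈ supportedIn A := by
  intro n hn
  rw [lp.single_apply]
  by_cases hk : n = k
  · subst hk; simp [h hn]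
  · simp [hk]

theorem tendsto_sum_range_single (x : lp (fun _ : ℕ => ℂ) 2) :
    Tendsto (fun m => ∑ i ∈ Finset.range m, lp.single 2 i (x i)) atTop (𝓝 x) :=
  (lp.hasSum_single (by simp) x).tendsto_sum_nat

/-- If `A` contains arbitrarily long intervals arbitrarily far out, then twice the backward shift
has a hypercyclic vector supported in `A`. -/
theorem exists_hypercyclic_supportedIn {A : Set ℕ}
    (hA : ∀ L N : ℕ, ∃ n ≥ N, ∀ i < L, n + i ∈ A)
    {T : lp (fun _ : ℕ => ℂ) 2 →L[ℂ] lp (fun _ : ℕ => ℂ) 2}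
    (hT : ∀ (n : ℕ) (x : lp (fun _ : ℕ => ℂ) 2) (k : ℕ), (T ^ n) x k = 2 ^ n * x (n + k)) :
    ∃ x ∈ supportedIn A, Dense (Set.range fun n : ℕ => (T ^ n) x) := by
  have hlt : ∀ (n k : ℕ) (a : ℂ), k < n → (T ^ n) (lp.single 2 k a) = 0 := by
    intro n k a hk
    ext j
    rw [hT, lp.single_apply, Pi.single_eq_of_ne (by omega)]
    simp
  have hge : ∀ (n k : ℕ) (a : ℂ),
      (T ^ n) (lp.single 2 (n + k) ((2 ^ n)⁻¹ * a)) = lp.single 2 k a := by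
    intro n k a
    ext j
    rw [hT, lp.single_apply, lp.single_apply]
    by_cases h : j = k
    · subst h; simp
    · rw [Pi.single_eq_of_ne (by omega), Pi.single_eq_of_ne h, mul_zero]
  have := separableSpace_lp_two
  have := UniformSpace.secondCountable_of_separable (lp (fun _ : ℕ => ℂ) 2)
  have : CompleteSpace (supportedIn A) := (isClosed_supportedIn A).completeSpace_coe
  let b := TopologicalSpace.countableBasis (lp (fun _ : ℕ => ℂ) 2)
  have hb := TopologicalSpace.isBasis_countableBasis (lp (fun _ : ℕ => ℂ) 2)
  let V : Set (lp (fun _ : ℕ => ℂ) 2) → Set (supportedIn A) :=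
    fun U => ⋃ n : ℕ, (fun x : supportedIn A => (T ^ n) (x : lp (fun _ : ℕ => ℂ) 2)) ⁻¹' U
  have hdense : Dense (⋂ U ∈ b, V U) := by
    refine dense_biInter_of_isOpen (fun U hU => isOpen_iUnion fun n =>
      (TopologicalSpace.isOpen_of_mem_countableBasis hU).preimage
        ((T ^ n).continuous.comp continuous_subtype_val))
      (TopologicalSpace.countable_countableBasis _) fun U hU => ?_
    obtain ⟨y, hy⟩ := TopologicalSpace.nonempty_of_mem_countableBasis hU
    obtain ⟨L, hL⟩ := ((tendsto_sum_range_single y).eventually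
      ((TopologicalSpace.isOpen_of_mem_countableBasis hU).mem_nhds hy)).exists
    intro x
    rw [Metric.mem_closure_iff]
    intro ε hε
    obtain ⟨M, hM⟩ := ((tendsto_sum_range_single (x : lp (fun _ : ℕ => ℂ) 2)).eventually
      (Metric.ball_mem_nhds _ (half_pos hε))).exists
    have hw : Tendsto (fun n : ℕ => ∑ i ∈ Finset.range L, ((2 : ℝ)⁻¹) ^ n * ‖y i‖) atTop (𝓝 0) := by
      have := tendsto_finsetSum (Finset.range L) fun i _ =>
        (tendsto_pow_atTop_nhds_zero_of_lt_one (r := (2 : ℝ)⁻¹) (by norm_num)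
          (by norm_num)).mul_const ‖y i‖
      simpa using this
    obtain ⟨N, hN⟩ := eventually_atTop.1 (hw.eventually (gt_mem_nhds (half_pos hε)))
    obtain ⟨n, hn, hnA⟩ := hA L (max M N)
    let u : lp (fun _ : ℕ => ℂ) 2 := ∑ i ∈ Finset.range M, lp.single 2 i (x.1 i)
    let w : lp (fun _ : ℕ => ℂ) 2 :=
      ∑ i ∈ Finset.range L, lp.single 2 (n + i) ((2 ^ n)⁻¹ * y i)
    have hu : u ∈ supportedIn A := Submodule.sum_mem _ fun i _ =>
      single_mem_supportedIn fun hi => x.2 i hi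
    have hwA : w ∈ supportedIn A := Submodule.sum_mem _ fun i hi =>
      single_mem_supportedIn fun h => absurd (hnA i (Finset.mem_range.1 hi)) h
    have hwn : ‖w‖ < ε / 2 := by
      refine ((norm_sum_le _ _).trans (le_of_eq ?_)).trans_lt (hN n (by omega))
      refine Finset.sum_congr rfl fun i _ => ?_
      rw [lp.norm_single (by norm_num)]
      simp
    refine ⟨⟨u + w, add_mem hu hwA⟩, Set.mem_iUnion.2 ⟨n, ?_⟩, ?_⟩
    · have h1 : (T ^ n) u = 0 := by
        rw [map_sum]
        exact Finset.sum_eq_zero fun i hi =>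
          hlt _ _ _ (by have := Finset.mem_range.1 hi; omega)
      have h2 : (T ^ n) w = ∑ i ∈ Finset.range L, lp.single 2 i (y i) := by
        rw [map_sum]
        exact Finset.sum_congr rfl fun i _ => hge _ _ _
      change (T ^ n) (u + w) ∈ U
      rw [map_add, h1, h2, zero_add]
      exact hL
    · change dist (x : lp (fun _ : ℕ => ℂ) 2) (u + w) < ε
      have h1 : dist (x : lp (fun _ : ℕ => ℂ) 2) u < ε / 2 := by
        rw [dist_comm]; exact hM
      have h2 : dist u (u + w) = ‖w‖ := by simp
      linarith [dist_triangle (x : lp (fun _ : ℕ => ℂ) 2) u (u + w)]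
  obtain ⟨x, hx⟩ := hdense.nonempty
  refine ⟨x, x.2, hb.dense_iff.2 fun U hU _ => ?_⟩
  obtain ⟨n, hn⟩ := Set.mem_iUnion.1 (Set.mem_iInter₂.1 hx U hU)
  exact ⟨_, hn, n, rfl⟩

theorem exists_long_interval_cos_log_nonpos (L N : ℕ) :
    ∃ n ≥ N, ∀ i < L, Real.cos (Real.log ((n + i : ℕ) : ℝ)) ≤ 0 := by
  set k := N + L with hk
  set s : ℝ := Real.pi / 2 + k * (2 * Real.pi) with hs
  have hpi := Real.pi_gt_three
  have hE : (k : ℝ) + 1 ≤ Real.exp s := by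
    have := Real.add_one_le_exp s
    nlinarith [(Nat.cast_nonneg k : (0 : ℝ) ≤ k)]
  have hkr : (k : ℝ) = N + L := by rw [hk]; push_cast; ring
  have hNr : (0 : ℝ) ≤ N := Nat.cast_nonneg N
  have hLr : (0 : ℝ) ≤ L := Nat.cast_nonneg L
  have hceil := Nat.le_ceil (Real.exp s)
  refine ⟨⌈Real.exp s⌉₊, ?_, fun i hi => ?_⟩
  · have : (N : ℝ) ≤ ⌈Real.exp s⌉₊ := by linarith
    exact_mod_cast this
  · have hceil' := Nat.ceil_lt_add_one (Real.exp_pos s).le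
    have hir : (i : ℝ) < L := by exact_mod_cast hi
    have hi0 : (0 : ℝ) ≤ i := Nat.cast_nonneg i
    have h1 : Real.exp s ≤ ((⌈Real.exp s⌉₊ + i : ℕ) : ℝ) := by push_cast; linarith
    have h2 : ((⌈Real.exp s⌉₊ + i : ℕ) : ℝ) ≤ Real.exp (s + Real.pi) := by
      rw [Real.exp_add s Real.pi]
      have := Real.add_one_le_exp Real.pi
      push_cast
      nlinarith
    have hpos := (Real.exp_pos s).trans_le h1
    have h3 := (Real.le_log_iff_exp_le hpos).2 h1
    have h4 := (Real.log_le_iff_le_exp hpos).2 h2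
    rw [← Real.cos_sub_nat_mul_two_pi _ k]
    exact Real.cos_nonpos_of_pi_div_two_le_of_le (by linarith) (by linarith)

/-- Let `T = 2B` where `B` is the unweighted backward shift on
`ℓ²(ℤ₊)` (characterized by `(B x)(n) = x(n+1)`). There exists `x ∈ HC(T)` such that
`(e_0, 1)` does not belong to the closure of `{(T^n x, e^{i log n}) : n ≥ 1}` in
`ℓ²(ℤ₊) × ℂ`. -/
theorem stmt16
    (B : lp (fun _ : ℕ => ℂ) 2 →L[ℂ] lp (fun _ : ℕ => ℂ) 2)
    (hB : ∀ (x : lp (fun _ : ℕ => ℂ) 2) (n : ℕ), (B x : ℕ → ℂ) n = (x : ℕ → ℂ) (n + 1))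
    (T : lp (fun _ : ℕ => ℂ) 2 →L[ℂ] lp (fun _ : ℕ => ℂ) 2)
    (hT : T = (2 : ℂ) • B) :
    ∃ x : lp (fun _ : ℕ => ℂ) 2,
      Dense (Set.range fun n : ℕ => (T ^ n) x) ∧
      (lp.single 2 (0 : ℕ) (1 : ℂ), (1 : ℂ)) ∉
        closure {q : lp (fun _ : ℕ => ℂ) 2 × ℂ | ∃ n : ℕ, 1 ≤ n ∧
          q = ((T ^ n) x, Complex.exp (Complex.I * Complex.ofReal (Real.log (n : ℝ))))} := by
  have hpow : ∀ (n : ℕ) (x : lp (fun _ : ℕ => ℂ) 2) (k : ℕ),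
      (T ^ n) x k = 2 ^ n * x (n + k) := by
    intro n
    induction n with
    | zero => intro x k; simp
    | succ n ih =>
      intro x k
      have h : (T ^ (n + 1)) x = (T ^ n) (T x) := by rw [pow_succ]; rfl
      have h2 : T x (n + k) = 2 * x (n + k + 1) := by
        rw [hT, ← hB]; rfl
      rw [h, ih, h2, show n + 1 + k = n + k + 1 by ring]
      ring
  obtain ⟨x, hxA, hx⟩ := exists_hypercyclic_supportedIn
    (A := {n : ℕ | Real.cos (Real.log (n : ℝ)) ≤ 0}) exists_long_interval_cos_log_nonpos hpow
  refine ⟨x, hx, fun hmem => ?_⟩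
  have hopen : IsOpen {q : lp (fun _ : ℕ => ℂ) 2 × ℂ | q.1 0 ≠ 0 ∧ 0 < q.2.re} :=
    (isOpen_ne_fun ((continuous_lp_apply 0).comp continuous_fst) continuous_const).inter
      (isOpen_lt continuous_const (Complex.continuous_re.comp continuous_snd))
  obtain ⟨q, ⟨hq0, hqre⟩, n, -, rfl⟩ := mem_closure_iff.1 hmem _ hopen (by simp)
  have hre : (Complex.exp (Complex.I * Complex.ofReal (Real.log (n : ℝ)))).re
      = Real.cos (Real.log (n : ℝ)) := by
    rw [mul_comm, Complex.exp_ofReal_mul_I_re]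
  refine hq0 ?_
  change (T ^ n) x 0 = 0
  rw [hpow, add_zero, hxA n (not_le.2 (hre ▸ hqre)), mul_zero]
end

section
/- Let T = 2B, where B is the unweighted backward shift on ℓ²(ℤ₊). There exist a sequence of real numbers (f(n)) which is uniformly distributed modulo 1 and a vector x ∈ HC(T) such that the set {e^{2πi f(n)} T^n x : n ≥ 1} is not dense in ℓ²(ℤ₊). -/
open Filter Topology

open scoped Classical in
/-- A sequence of real numbers `(f(n))` is uniformly distributed modulo 1 if for all
`0 ≤ a ≤ b ≤ 1`, `(1/N)·card {1 ≤ n ≤ N : fract (f n) ∈ [a, b)} → b − a`. -/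
def UnifDistMod1 (f : ℕ → ℝ) : Prop :=
  ∀ a b : ℝ, 0 ≤ a → a ≤ b → b ≤ 1 →
    Filter.Tendsto
      (fun N : ℕ =>
        (((Finset.Icc 1 N).filter (fun n => Int.fract (f n) ∈ Set.Ico a b)).card : ℝ) / N)
      Filter.atTop (nhds (b - a))

/-- The complex Hilbert space of square-summable sequences. -/
abbrev EllTwo : Type := lp (fun _ : ℕ => ℂ) 2

section EllTwo

instance EllTwo.separableSpace : TopologicalSpace.SeparableSpace EllTwo := by
  have hsep : TopologicalSpace.IsSeparable
      (closure (Submodule.span ℂ (Set.range fun i : ℕ => lp.single (E := fun _ : ℕ => ℂ) 2 i 1) :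
        Set EllTwo)) :=
    ((Set.countable_range _).isSeparable.span (R := ℂ)).closure
  rw [← TopologicalSpace.isSeparable_univ_iff]
  refine hsep.mono fun z _ => ?_
  refine mem_closure_of_tendsto (lp.hasSum_single (by simp) z) (Eventually.of_forall fun s => ?_)
  refine Submodule.sum_mem _ fun i _ => ?_
  have : lp.single (E := fun _ : ℕ => ℂ) 2 i (z i) = z i • lp.single 2 i (1 : ℂ) := by
    rw [← lp.single_smul]; simp
  rw [this]
  exact Submodule.smul_mem _ _ (Submodule.subset_span ⟨i, rfl⟩)

lemma EllTwo.norm_sq_eq_tsum (z : EllTwo) : ‖z‖ ^ 2 = ∑' j, ‖z j‖ ^ 2 := by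
  have := lp.norm_rpow_eq_tsum (p := 2) (by simp) z
  simpa using this

lemma EllTwo.summable_norm_sq (z : EllTwo) : Summable fun j => ‖z j‖ ^ 2 := by
  have := (lp.memℓp z).summable (by simp)
  simpa using this

/-- Dominated convergence in `ℓ²`. -/
lemma EllTwo.tendsto_zero_of_dominated {v : ℕ → EllTwo} {g : ℕ → ℝ}
    (hg : Summable fun j => g j ^ 2) (hb : ∀ᶠ k in atTop, ∀ j, ‖v k j‖ ≤ g j)
    (h0 : ∀ j, Tendsto (fun k => v k j) atTop (𝓝 0)) : Tendsto v atTop (𝓝 0) := by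
  have h : Tendsto (fun k => ∑' j, ‖v k j‖ ^ 2) atTop (𝓝 (∑' _ : ℕ, (0 : ℝ))) := by
    refine tendsto_tsum_of_dominated_convergence hg (fun j => ?_) ?_
    · simpa using ((h0 j).norm).pow 2
    · filter_upwards [hb] with k hk j
      rw [Real.norm_of_nonneg (by positivity)]
      gcongr
      exact hk j
  simp only [tsum_zero, ← EllTwo.norm_sq_eq_tsum] at h
  rw [tendsto_zero_iff_norm_tendsto_zero]
  have := h.sqrt
  simpa [Real.sqrt_sq] using this

end EllTwo

section SparseVector

/-- Places the first `k` coordinates of `y k`, divided by `2 ^ 4 ^ k`, at the positions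
`4 ^ k, …, 4 ^ k + k - 1`, omitting the vectors with `‖y k‖ > 2 ^ k`. -/
noncomputable def sparseFun (y : ℕ → EllTwo) (m : ℕ) : ℂ :=
  if m - 4 ^ Nat.log 4 m < Nat.log 4 m ∧ ‖y (Nat.log 4 m)‖ ≤ 2 ^ Nat.log 4 m then
    y (Nat.log 4 m) (m - 4 ^ Nat.log 4 m) / 2 ^ 4 ^ Nat.log 4 m
  else 0

lemma log_four_pow_add {k i : ℕ} (hi : i < 3 * 4 ^ k) : Nat.log 4 (4 ^ k + i) = k := by
  rw [Nat.log_eq_iff (by simp)]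
  constructor
  · omega
  · rw [pow_succ]; omega

lemma lt_three_mul_four_pow (k : ℕ) : k < 3 * 4 ^ k := by
  have := Nat.lt_pow_self (n := k) (a := 4) (by norm_num)
  omega

lemma sparseFun_of_lt {y : ℕ → EllTwo} {k i : ℕ} (hi : i < k) (hy : ‖y k‖ ≤ 2 ^ k) :
    sparseFun y (4 ^ k + i) = y k i / 2 ^ 4 ^ k := by
  rw [sparseFun, log_four_pow_add (hi.trans (lt_three_mul_four_pow k)), Nat.add_sub_cancel_left,
    if_pos ⟨hi, hy⟩]

lemma sparseFun_of_le {y : ℕ → EllTwo} {k i : ℕ} (hk : k ≤ i) (hi : i < 3 * 4 ^ k) :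
    sparseFun y (4 ^ k + i) = 0 := by
  rw [sparseFun, log_four_pow_add hi, Nat.add_sub_cancel_left, if_neg (by omega)]

lemma sub_lt_log_of_sparseFun_ne_zero {y : ℕ → EllTwo} {m : ℕ} (h : sparseFun y m ≠ 0) :
    m - 4 ^ Nat.log 4 m < Nat.log 4 m := by
  by_contra h'
  exact h (if_neg fun h'' => h' h''.1)

lemma norm_sparseFun_le (y : ℕ → EllTwo) (m : ℕ) : ‖sparseFun y m‖ ≤ m / 2 ^ m := by
  unfold sparseFun
  split_ifs with h
  · obtain ⟨h1, h2⟩ := h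
    set k := Nat.log 4 m with hk
    have hm : m ≠ 0 := by rintro rfl; simp at hk; omega
    have h4 : 4 ^ k ≤ m := Nat.pow_log_le_self 4 hm
    have hcoord : ‖y k (m - 4 ^ k)‖ ≤ 2 ^ k := (lp.norm_apply_le_norm (by simp) _ _).trans h2
    rw [norm_div, norm_pow, Complex.norm_ofNat, div_le_div_iff₀ (by positivity) (by positivity)]
    calc ‖y k (m - 4 ^ k)‖ * 2 ^ m ≤ 2 ^ k * 2 ^ (4 ^ k + k) := by
          gcongr
          · norm_num
          · omega
      _ = (4 : ℝ) ^ k * 2 ^ 4 ^ k := by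
          rw [pow_add, show (4 : ℝ) = 2 * 2 by norm_num, mul_pow]; ring
      _ ≤ m * 2 ^ 4 ^ k := by
          gcongr
          exact_mod_cast h4
  · simp only [norm_zero]; positivity

lemma summable_mul_div_two_pow_sq (c : ℝ) :
    Summable fun m : ℕ => (c * (m / 2 ^ m : ℝ)) ^ 2 := by
  have h := (summable_pow_mul_geometric_of_norm_lt_one 2
    (show ‖(1 / 4 : ℝ)‖ < 1 by norm_num)).mul_left (c ^ 2)
  refine h.congr fun m => ?_
  rw [mul_pow, div_pow, div_pow, one_pow, ← pow_mul, mul_comm m 2, pow_mul, mul_one_div]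
  norm_num

/-- The vector of `ℓ²` with coordinates `sparseFun y`. -/
noncomputable def sparseVec (y : ℕ → EllTwo) : EllTwo :=
  ⟨sparseFun y, memℓp_gen <| by
    refine Summable.of_nonneg_of_le (fun m => by positivity) (fun m => ?_)
      (summable_mul_div_two_pow_sq 1)
    simp only [ENNReal.toReal_ofNat, Real.rpow_ofNat, one_mul]
    gcongr
    exact norm_sparseFun_le y m⟩

lemma sparseVec_apply (y : ℕ → EllTwo) (m : ℕ) : sparseVec y m = sparseFun y m := rfl

variable {T : EllTwo →L[ℂ] EllTwo} (hT : ∀ (n : ℕ) (z : EllTwo) (j : ℕ),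
  (T ^ n) z j = 2 ^ n * z (n + j))

include hT in
lemma norm_iterate_sparseVec_sub_apply_le {y : ℕ → EllTwo} {k : ℕ} (hy : ‖y k‖ ≤ 2 ^ k) (j : ℕ) :
    ‖((T ^ 4 ^ k) (sparseVec y) - y k) j‖ ≤
      if j < k then 0 else ‖y k j‖ + 2 * (j / 2 ^ j) := by
  have hcoe : ((T ^ 4 ^ k) (sparseVec y) - y k) j =
      2 ^ 4 ^ k * sparseFun y (4 ^ k + j) - y k j := by
    rw [lp.coeFn_sub, Pi.sub_apply, hT, sparseVec_apply]
  rw [hcoe]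
  split_ifs with hj
  · rw [sparseFun_of_lt hj hy, mul_div_cancel₀ _ (pow_ne_zero _ two_ne_zero)]
    simp
  · refine (norm_sub_le _ _).trans ?_
    rw [add_comm]
    gcongr
    by_cases hj3 : j < 3 * 4 ^ k
    · rw [sparseFun_of_le (by omega) hj3]
      simp only [mul_zero, norm_zero]
      positivity
    · rw [norm_mul, norm_pow, Complex.norm_ofNat]
      calc (2 : ℝ) ^ 4 ^ k * ‖sparseFun y (4 ^ k + j)‖
          ≤ 2 ^ 4 ^ k * (((4 ^ k + j : ℕ) : ℝ) / 2 ^ (4 ^ k + j)) := by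
            gcongr
            exact norm_sparseFun_le y _
        _ = ((4 ^ k + j : ℕ) : ℝ) / 2 ^ j := by
            rw [pow_add]
            field_simp
        _ ≤ (2 * j : ℝ) / 2 ^ j := by
            gcongr
            exact_mod_cast (by omega : 4 ^ k + j ≤ 2 * j)
        _ = 2 * (j / 2 ^ j : ℝ) := by ring

include hT in
lemma dense_range_iterate_sparseVec :
    Dense (Set.range fun n : ℕ => (T ^ n)
      (sparseVec fun k => TopologicalSpace.denseSeq EllTwo (Nat.unpair k).1)) := by
  set y : ℕ → EllTwo := fun k => TopologicalSpace.denseSeq EllTwo (Nat.unpair k).1 with hy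
  refine Dense.of_closure ((TopologicalSpace.denseRange_denseSeq EllTwo).mono ?_)
  rintro _ ⟨i, rfl⟩
  set z := TopologicalSpace.denseSeq EllTwo i with hz
  have hyz : ∀ l, y (Nat.pair i l) = z := fun l => by simp [hy, hz]
  have hle : ∀ l, l ≤ Nat.pair i l := Nat.right_le_pair i
  have hnorm : ∀ᶠ l : ℕ in atTop, ‖z‖ ≤ 2 ^ Nat.pair i l := by
    filter_upwards [(tendsto_pow_atTop_atTop_of_one_lt
      (one_lt_two : (1 : ℝ) < 2)).eventually_ge_atTop ‖z‖] with l hl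
    exact hl.trans (pow_le_pow_right₀ one_le_two (hle l))
  have hbound : ∀ᶠ l : ℕ in atTop, ∀ j,
      ‖((T ^ 4 ^ Nat.pair i l) (sparseVec y) - z) j‖ ≤
        if j < Nat.pair i l then 0 else ‖z j‖ + 2 * (j / 2 ^ j) := by
    filter_upwards [hnorm] with l hl j
    have := norm_iterate_sparseVec_sub_apply_le hT (y := y) (k := Nat.pair i l)
      (by rwa [hyz]) j
    rwa [hyz] at this
  have hlim : Tendsto (fun l : ℕ => (T ^ 4 ^ Nat.pair i l) (sparseVec y) - z) atTop (𝓝 0) := by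
    refine EllTwo.tendsto_zero_of_dominated (g := fun j => ‖z j‖ + 2 * (j / 2 ^ j)) ?_ ?_ ?_
    · refine Summable.of_nonneg_of_le (fun j => by positivity) (fun j => add_sq_le)
        (((EllTwo.summable_norm_sq z).add (summable_mul_div_two_pow_sq 2)).mul_left 2)
    · filter_upwards [hbound] with l hl j
      refine (hl j).trans ?_
      split_ifs
      · positivity
      · exact le_rfl
    · intro j
      refine tendsto_const_nhds.congr' ?_
      filter_upwards [hbound, eventually_gt_atTop j] with l hl hjl
      have := hl j
      rw [if_pos (hjl.trans_le (hle l))] at this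
      exact (norm_le_zero_iff.1 this).symm
  have hlim' := hlim.add_const z
  simp only [sub_add_cancel, zero_add] at hlim'
  exact mem_closure_of_tendsto hlim' (Eventually.of_forall fun l => ⟨_, rfl⟩)

lemma card_support_sparseFun_le (y : ℕ → EllTwo) {N : ℕ} (hN : N ≠ 0) :
    ((Finset.range (N + 1)).filter fun n => sparseFun y n ≠ 0).card ≤ 4 * N.sqrt := by
  set L := Nat.log 4 N with hL
  have hcard : ((Finset.range (N + 1)).filter fun n => sparseFun y n ≠ 0).card ≤
      (Finset.range (L + 1) ×ˢ Finset.range (L + 1)).card := by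
    refine Finset.card_le_card_of_injOn (fun n => (Nat.log 4 n, n - 4 ^ Nat.log 4 n)) ?_ ?_
    · intro n hn
      simp only [Finset.coe_filter, Finset.mem_range, Set.mem_ofPred_eq] at hn
      have h1 := sub_lt_log_of_sparseFun_ne_zero hn.2
      have h2 : Nat.log 4 n ≤ L := Nat.log_mono_right (by omega)
      simp only [Finset.coe_product, Set.mem_prod, Finset.mem_coe, Finset.mem_range]
      omega
    · intro m hm n hn hmn
      simp only [Finset.coe_filter, Finset.mem_range, Set.mem_ofPred_eq] at hm hn
      simp only [Prod.mk.injEq] at hmn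
      have ne_zero_of : ∀ {m}, sparseFun y m ≠ 0 → m ≠ 0 := by
        rintro m hm rfl
        have := sub_lt_log_of_sparseFun_ne_zero hm
        simp at this
      have h1 := Nat.pow_log_le_self 4 (ne_zero_of hm.2)
      have h2 := Nat.pow_log_le_self 4 (ne_zero_of hn.2)
      obtain ⟨h3, h4⟩ := hmn
      rw [h3] at h1 h4
      omega
  have hsq : ∀ l : ℕ, (l + 1) * (l + 1) ≤ 4 * 2 ^ l := by
    intro l
    induction l using Nat.strong_induction_on with
    | _ l ih =>
      rcases lt_or_ge l 3 with h | h
      · interval_cases l <;> norm_num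
      · obtain ⟨l, rfl⟩ := Nat.exists_eq_add_of_le' (show 1 ≤ l by omega)
        have := ih l (by omega)
        rw [pow_succ]
        nlinarith
  have hpow : 2 ^ L ≤ N.sqrt := by
    rw [Nat.le_sqrt, ← mul_pow]
    exact Nat.pow_log_le_self 4 hN
  rw [Finset.card_product, Finset.card_range] at hcard
  have := hsq L
  omega

end SparseVector

section Equidistribution

/-- The concatenation of the blocks `i / (2 k + 1)`, `0 ≤ i ≤ 2 k`, the `k`-th block starting
at position `k ^ 2`. -/
noncomputable def blockSeq (n : ℕ) : ℝ :=
  ((n - n.sqrt * n.sqrt : ℕ) : ℝ) / ((2 * n.sqrt + 1 : ℕ) : ℝ)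

lemma blockSeq_mul_self_add {k i : ℕ} (hi : i < 2 * k + 1) :
    blockSeq (k * k + i) = (i : ℝ) / ((2 * k + 1 : ℕ) : ℝ) := by
  have : (k * k + i).sqrt = k := Nat.sqrt_add_eq k (by omega)
  rw [blockSeq, this, Nat.add_sub_cancel_left]

lemma fract_blockSeq (n : ℕ) : Int.fract (blockSeq n) = blockSeq n := by
  rw [Int.fract_eq_self]
  refine ⟨by unfold blockSeq; positivity, ?_⟩
  rw [blockSeq, div_lt_one (by positivity)]
  have := Nat.sqrt_le_add n
  exact_mod_cast (by omega : n - n.sqrt * n.sqrt < 2 * n.sqrt + 1)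

variable {a b : ℝ}

open scoped Classical in
lemma abs_card_filter_div_mem_Ico_sub_le (ha : 0 ≤ a) (hab : a ≤ b) (hb : b ≤ 1) {L : ℕ}
    (hL : 0 < L) :
    |(((Finset.range L).filter fun i : ℕ => (i : ℝ) / L ∈ Set.Ico a b).card : ℝ) - (b - a) * L| ≤
      1 := by
  have hL' : (0 : ℝ) < L := by exact_mod_cast hL
  have heq : (Finset.range L).filter (fun i : ℕ => (i : ℝ) / L ∈ Set.Ico a b) =
      Finset.Ico ⌈a * L⌉₊ ⌈b * L⌉₊ := by
    ext i
    simp only [Finset.mem_filter, Finset.mem_range, Set.mem_Ico, Finset.mem_Ico, Nat.ceil_le,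
      Nat.lt_ceil, le_div_iff₀ hL', div_lt_iff₀ hL']
    refine ⟨fun h => h.2, fun h => ⟨?_, h⟩⟩
    have : (i : ℝ) < L := by nlinarith [h.2]
    exact_mod_cast this
  have hle : ⌈a * L⌉₊ ≤ ⌈b * L⌉₊ := Nat.ceil_mono (by gcongr)
  rw [heq, Nat.card_Ico, Nat.cast_sub hle, abs_le]
  have h1 := Nat.le_ceil (a * L)
  have h2 := Nat.le_ceil (b * L)
  have h3 := Nat.ceil_lt_add_one (show 0 ≤ a * L by positivity)
  have h4 := Nat.ceil_lt_add_one (show 0 ≤ b * L from mul_nonneg (ha.trans hab) hL'.le)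
  constructor <;> linarith

open scoped Classical in
lemma abs_card_blockSeq_mul_self_sub_le (ha : 0 ≤ a) (hab : a ≤ b) (hb : b ≤ 1) (k : ℕ) :
    |(((Finset.range (k * k)).filter fun n => blockSeq n ∈ Set.Ico a b).card : ℝ) -
      (b - a) * (k * k : ℕ)| ≤ k := by
  induction k with
  | zero => simp
  | succ k ih =>
    have hsplit : ((Finset.range ((k + 1) * (k + 1))).filter
          fun n => blockSeq n ∈ Set.Ico a b).card =
        ((Finset.range (k * k)).filter fun n => blockSeq n ∈ Set.Ico a b).card +
        ((Finset.range (2 * k + 1)).filter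
          fun i : ℕ => (i : ℝ) / ((2 * k + 1 : ℕ) : ℝ) ∈ Set.Ico a b).card := by
      simp only [Finset.card_filter]
      rw [show (k + 1) * (k + 1) = k * k + (2 * k + 1) by ring, Finset.sum_range_add]
      congr 1
      refine Finset.sum_congr rfl fun i hi => ?_
      rw [blockSeq_mul_self_add (Finset.mem_range.1 hi)]
    have hblock := abs_card_filter_div_mem_Ico_sub_le ha hab hb (L := 2 * k + 1) (by omega)
    rw [hsplit]
    rw [abs_le] at ih hblock ⊢
    push_cast at ih hblock ⊢
    constructor <;> nlinarith [ih.1, ih.2, hblock.1, hblock.2]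

open scoped Classical in
lemma abs_card_blockSeq_sub_le (ha : 0 ≤ a) (hab : a ≤ b) (hb : b ≤ 1) (N : ℕ) :
    |(((Finset.range N).filter fun n => blockSeq n ∈ Set.Ico a b).card : ℝ) - (b - a) * N| ≤
      3 * N.sqrt := by
  set k := N.sqrt with hk
  have h1 : k * k ≤ N := Nat.sqrt_le N
  have h2 : N ≤ k * k + k + k := Nat.sqrt_le_add N
  have hsq := abs_card_blockSeq_mul_self_sub_le ha hab hb k
  set P : ℕ → Prop := fun n => blockSeq n ∈ Set.Ico a b
  have hle : ((Finset.range (k * k)).filter P).card ≤ ((Finset.range N).filter P).card :=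
    Finset.card_le_card (Finset.filter_subset_filter _ (Finset.range_mono h1))
  have hge : ((Finset.range N).filter P).card ≤
      ((Finset.range (k * k)).filter P).card + 2 * k := by
    rw [show N = k * k + (N - k * k) by omega, Finset.card_filter, Finset.sum_range_add,
      ← Finset.card_filter, ← Finset.card_filter]
    gcongr
    refine (Finset.card_filter_le _ _).trans ?_
    rw [Finset.card_range]
    omega
  have hle' : (((Finset.range (k * k)).filter P).card : ℝ) ≤ ((Finset.range N).filter P).card :=
    by exact_mod_cast hle
  have hge' : (((Finset.range N).filter P).card : ℝ) ≤
      ((Finset.range (k * k)).filter P).card + 2 * k := by exact_mod_cast hge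
  have h1' : ((k * k : ℕ) : ℝ) ≤ N := by exact_mod_cast h1
  have h2' : (N : ℝ) ≤ (k * k : ℕ) + 2 * k := by exact_mod_cast (by omega : N ≤ k * k + 2 * k)
  have h3 : (b - a) * (k * k : ℕ) ≤ (b - a) * N := mul_le_mul_of_nonneg_left h1' (by linarith)
  have h4 : (b - a) * (N - (k * k : ℕ)) ≤ 1 * (N - (k * k : ℕ)) :=
    mul_le_mul_of_nonneg_right (by linarith) (by linarith)
  rw [abs_le] at hsq ⊢
  constructor <;> nlinarith [hsq.1, hsq.2]

/-- A sequence that agrees with `blockSeq` off a set with `O(√N)` elements up to `N` is uniformly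
distributed modulo 1. -/
lemma unifDistMod1_of_eq_blockSeq {f : ℕ → ℝ} {S : ℕ → Prop} [DecidablePred S]
    (hf : ∀ n, ¬ S n → f n = blockSeq n) {C : ℕ}
    (hS : ∀ N, N ≠ 0 → ((Finset.range (N + 1)).filter S).card ≤ C * N.sqrt) :
    UnifDistMod1 f := by
  classical
  intro a b ha hab hb
  set P : ℕ → Prop := fun n => Int.fract (f n) ∈ Set.Ico a b
  set Q : ℕ → Prop := fun n => blockSeq n ∈ Set.Ico a b
  have hPQ : ∀ n, ¬ S n → (P n ↔ Q n) := fun n hn => by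
    simp only [P, Q, hf n hn, fract_blockSeq]
  have hbound : ∀ N : ℕ, N ≠ 0 →
      |(((Finset.Icc 1 N).filter P).card : ℝ) / N - (b - a)| ≤ (C + 4) * (Real.sqrt N)⁻¹ := by
    intro N hN
    have h1 : ((Finset.Icc 1 N).filter P).card ≤ ((Finset.range N).filter Q).card +
        ((Finset.range (N + 1)).filter S).card + 1 := by
      have hsub : (Finset.Icc 1 N).filter P ⊆ ((Finset.range N).filter Q ∪
          (Finset.range (N + 1)).filter S) ∪ {N} := by
        intro n hn
        have := hPQ n
        simp only [Finset.mem_filter, Finset.mem_Icc, Finset.mem_union, Finset.mem_range,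
          Finset.mem_singleton] at hn ⊢
        grind
      refine (Finset.card_le_card hsub).trans ((Finset.card_union_le _ _).trans ?_)
      gcongr
      · exact Finset.card_union_le _ _
      · simp
    have h2 : ((Finset.range N).filter Q).card ≤ ((Finset.Icc 1 N).filter P).card +
        ((Finset.range (N + 1)).filter S).card + 1 := by
      have hsub : (Finset.range N).filter Q ⊆ ((Finset.Icc 1 N).filter P ∪
          (Finset.range (N + 1)).filter S) ∪ {0} := by
        intro n hn
        have := hPQ n
        simp only [Finset.mem_filter, Finset.mem_Icc, Finset.mem_union, Finset.mem_range,
          Finset.mem_singleton] at hn ⊢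
        grind
      refine (Finset.card_le_card hsub).trans ((Finset.card_union_le _ _).trans ?_)
      gcongr
      · exact Finset.card_union_le _ _
      · simp
    have h3 := hS N hN
    have hs : 1 ≤ N.sqrt := Nat.sqrt_pos.2 (Nat.pos_of_ne_zero hN)
    have h4 := abs_card_blockSeq_sub_le ha hab hb N
    have h1' : (((Finset.Icc 1 N).filter P).card : ℝ) ≤
        ((Finset.range N).filter Q).card + (C * N.sqrt + N.sqrt) := by
      exact_mod_cast (by omega)
    have h2' : (((Finset.range N).filter Q).card : ℝ) ≤
        ((Finset.Icc 1 N).filter P).card + (C * N.sqrt + N.sqrt) := by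
      exact_mod_cast (by omega)
    have hN' : (0 : ℝ) < N := by exact_mod_cast Nat.pos_of_ne_zero hN
    have hsqrt : (N.sqrt : ℝ) ≤ Real.sqrt N := Real.nat_sqrt_le_real_sqrt
    have h5 : |(((Finset.Icc 1 N).filter P).card : ℝ) - (b - a) * N| ≤
        (C + 4) * Real.sqrt N := by
      have : |(((Finset.Icc 1 N).filter P).card : ℝ) - (b - a) * N| ≤ (C + 4) * N.sqrt := by
        rw [abs_le] at h4 ⊢
        constructor <;> linarith [h4.1, h4.2]
      exact this.trans (by gcongr)
    have h6 : (((Finset.Icc 1 N).filter P).card : ℝ) / N - (b - a) =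
        (((Finset.Icc 1 N).filter P).card - (b - a) * N) / N := by
      field_simp
    rw [h6, abs_div, abs_of_pos hN', div_le_iff₀ hN', mul_assoc]
    refine h5.trans_eq ?_
    congr 1
    rw [inv_mul_eq_div, Real.div_sqrt]
  have hzero : Tendsto (fun N : ℕ => ((C : ℝ) + 4) * (Real.sqrt N)⁻¹) atTop (𝓝 0) := by
    have := (tendsto_inv_atTop_zero.comp
      (Real.tendsto_sqrt_atTop.comp tendsto_natCast_atTop_atTop)).const_mul ((C : ℝ) + 4)
    simpa using this
  rw [tendsto_iff_dist_tendsto_zero]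
  refine squeeze_zero' (Eventually.of_forall fun _ => dist_nonneg) ?_ hzero
  filter_upwards [eventually_ne_atTop 0] with N hN
  rw [Real.dist_eq]
  convert hbound N hN

end Equidistribution

/-- Every complex number can be rotated onto the nonpositive real axis. -/
lemma exists_re_exp_two_pi_I_mul_le_zero (w : ℂ) :
    ∃ t : ℝ, (Complex.exp (2 * Real.pi * Complex.I * (t : ℂ)) * w).re ≤ 0 := by
  refine ⟨(Real.pi - w.arg) / (2 * Real.pi), ?_⟩
  have hpi : (Real.pi : ℂ) ≠ 0 := by exact_mod_cast Real.pi_ne_zero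
  have harg : 2 * Real.pi * Complex.I * (((Real.pi - w.arg) / (2 * Real.pi) : ℝ) : ℂ) =
      Real.pi * Complex.I - w.arg * Complex.I := by
    push_cast
    field_simp
  have hw : Complex.exp (Real.pi * Complex.I - w.arg * Complex.I) * w = -(‖w‖ : ℂ) := by
    rw [Complex.exp_sub, Complex.exp_pi_mul_I, div_mul_eq_mul_div,
      div_eq_iff (Complex.exp_ne_zero _), neg_one_mul, neg_mul, Complex.norm_mul_exp_arg_mul_I]
  rw [harg, hw]
  simp

lemma iterate_two_smul_backwardShift_apply {B : EllTwo →L[ℂ] EllTwo}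
    (hB : ∀ (x : EllTwo) (n : ℕ), B x n = x (n + 1)) (n : ℕ) (z : EllTwo) (j : ℕ) :
    (((2 : ℂ) • B) ^ n) z j = 2 ^ n * z (n + j) := by
  induction n generalizing z with
  | zero => simp
  | succ n ih =>
    rw [pow_succ, mul_apply_eq_comp, ih]
    rw [smul_apply, lp.coeFn_smul, Pi.smul_apply, hB, smul_eq_mul,
      pow_succ, mul_assoc, show n + 1 + j = n + j + 1 by ring]

/-- Let `T = 2B` where `B` is the unweighted backward shift on
`ℓ²(ℤ₊)` (characterized by `(B x)(n) = x(n+1)`). There exist a uniformly distributed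
(mod 1) sequence of reals `(f(n))` and `x ∈ HC(T)` such that
`{e^{2πi f(n)} T^n x : n ≥ 1}` is not dense in `ℓ²(ℤ₊)`. -/
theorem stmt18
    (B : lp (fun _ : ℕ => ℂ) 2 →L[ℂ] lp (fun _ : ℕ => ℂ) 2)
    (hB : ∀ (x : lp (fun _ : ℕ => ℂ) 2) (n : ℕ), (B x : ℕ → ℂ) n = (x : ℕ → ℂ) (n + 1))
    (T : lp (fun _ : ℕ => ℂ) 2 →L[ℂ] lp (fun _ : ℕ => ℂ) 2)
    (hT : T = (2 : ℂ) • B) :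
    ∃ (f : ℕ → ℝ) (x : lp (fun _ : ℕ => ℂ) 2),
      UnifDistMod1 f ∧
      Dense (Set.range fun n : ℕ => (T ^ n) x) ∧
      ¬ Dense {y : lp (fun _ : ℕ => ℂ) 2 | ∃ n : ℕ, 1 ≤ n ∧
        y = Complex.exp (2 * Real.pi * Complex.I * Complex.ofReal (f n)) • (T ^ n) x} := by
  classical
  subst hT
  have hiter := iterate_two_smul_backwardShift_apply hB
  set y : ℕ → EllTwo := fun k => TopologicalSpace.denseSeq EllTwo (Nat.unpair k).1
  choose θ hθ using exists_re_exp_two_pi_I_mul_le_zero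
  set f : ℕ → ℝ := fun n =>
    if sparseFun y n ≠ 0 then θ (2 ^ n * sparseFun y n) else blockSeq n with hf
  refine ⟨f, sparseVec y, ?_, dense_range_iterate_sparseVec hiter, fun hdense => ?_⟩
  · exact unifDistMod1_of_eq_blockSeq (S := fun n => sparseFun y n ≠ 0)
      (fun n hn => by simp only [hf]; rw [if_neg hn]) (C := 4)
      (fun N hN => by convert card_support_sparseFun_le y hN)
  · have hclosed : IsClosed {v : EllTwo | (v 0).re ≤ 0} := by
      have : Continuous fun v : EllTwo => (v 0).re :=
        Complex.continuous_re.comp ((lp.lipschitzWith_one_eval 2 0).continuous)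
      exact isClosed_le this continuous_const
    have hmem : lp.single (E := fun _ : ℕ => ℂ) 2 0 1 ∈ {v : EllTwo | (v 0).re ≤ 0} := by
      refine hclosed.closure_subset_iff.2 ?_ (hdense _)
      rintro _ ⟨n, -, rfl⟩
      rw [Set.mem_ofPred_eq, lp.coeFn_smul, Pi.smul_apply, hiter, smul_eq_mul, add_zero,
        sparseVec_apply]
      by_cases hn : sparseFun y n = 0
      · simp [hn]
      · simp only [hf]
        rw [if_pos hn]
        exact hθ _
    rw [Set.mem_ofPred_eq, lp.single_apply_self] at hmem
    norm_num at hmem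
end
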